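/- arXiv:1610.08156 — 4 statements merged into one kernel-verified Lean document; each statement's English description precedes it below -/
import Mathlib

section
/- Let R be a commutative Noetherian ring with 1, let M be a finitely generated R-module, and let d be the Krull dimension of R. If for every maximal ideal p of R the vector space M ⊗_R Frac(R/p) over the residue field Frac(R/p) can be generated by n elements, then M can be generated by n + d elements as an R-module. -/
open TensorProduct

namespace Module

variable {R : Type*} [CommRing R] (M : Type*) [AddCommGroup M] [Module R M]

/-- The minimal number of generators of the fiber of `M` at `p`. -/
noncomputable def fiberRank (p : PrimeSpectrum R) : ℕ :=
  finrank p.asIdeal.ResidueField (p.asIdeal.ResidueField ⊗[R] M)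

variable {M}

lemma fiberRank_pos_iff [Module.Finite R M] (p : PrimeSpectrum R) :
    0 < fiberRank M p ↔ p ∈ support R M := by
  rw [mem_support_iff_nontrivial_residueField_tensorProduct, fiberRank, finrank_pos_iff]

lemma subsingleton_tensorProduct_quotient_iff (A : Type*) [CommRing A] [Algebra R A]
    (N : Submodule R M) : Subsingleton (A ⊗[R] (M ⧸ N)) ↔ N.baseChange A = ⊤ := by
  have hsurj : Function.Surjective (N.mkQ.lTensor A) := N.mkQ.lTensor_surjective A N.mkQ_surjective
  have hex := lTensor_exact A (LinearMap.exact_subtype_mkQ N) N.mkQ_surjective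
  constructor
  · intro h
    rw [eq_top_iff]
    intro x _
    exact (hex x).1 (Subsingleton.elim _ _)
  · intro h
    refine subsingleton_of_forall_eq 0 fun y ↦ ?_
    obtain ⟨x, rfl⟩ := hsurj y
    have hx : x ∈ N.baseChange A := h ▸ Submodule.mem_top
    exact (hex x).2 hx

lemma exists_finset_card_eq_fiberRank [Module.Finite R M] (p : PrimeSpectrum R) :
    ∃ s : Finset M, s.card ≤ fiberRank M p ∧
      (Submodule.span R (s : Set M)).baseChange p.asIdeal.ResidueField = ⊤ := by
  classical
  let K := p.asIdeal.ResidueField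
  obtain ⟨f, hf, hspan, -⟩ :=
    Submodule.exists_fun_fin_finrank_span_eq K (Set.range (TensorProduct.mk R K M 1))
  have htop : Submodule.span K (Set.range (TensorProduct.mk R K M 1)) = ⊤ := by
    rw [← Set.image_univ, ← Submodule.baseChange_span, Submodule.span_univ,
      Submodule.baseChange_top]
  choose g hg using hf
  refine ⟨Finset.univ.image g, Finset.card_image_le.trans ?_, ?_⟩
  · rw [Finset.card_univ, Fintype.card_fin, htop, finrank_top, fiberRank]
  · rw [Submodule.baseChange_span, Finset.coe_image, Finset.coe_univ, Set.image_univ,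
      ← Set.range_comp, show _ ∘ g = f from funext hg]
    exact hspan.trans htop

lemma fiberRank_le_of_baseChange_eq_top (p : PrimeSpectrum R) (s : Finset M)
    (h : (Submodule.span R (s : Set M)).baseChange p.asIdeal.ResidueField = ⊤) :
    fiberRank M p ≤ s.card := by
  classical
  rw [Submodule.baseChange_span, ← Finset.coe_image] at h
  rw [fiberRank, ← finrank_top, ← h]
  exact (finrank_span_finset_le_card _).trans Finset.card_image_le

/-- Upper semicontinuity of the fiber rank. -/
lemma exists_ideal_fiberRank_le [Module.Finite R M] (p : PrimeSpectrum R) :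
    ∃ I : Ideal R, ¬ I ≤ p.asIdeal ∧
      ∀ q : PrimeSpectrum R, ¬ I ≤ q.asIdeal → fiberRank M q ≤ fiberRank M p := by
  obtain ⟨s, hs, htop⟩ := exists_finset_card_eq_fiberRank (M := M) p
  have key (q : PrimeSpectrum R) :
      ¬ annihilator R (M ⧸ Submodule.span R (s : Set M)) ≤ q.asIdeal ↔
        (Submodule.span R (s : Set M)).baseChange q.asIdeal.ResidueField = ⊤ := by
    rw [← subsingleton_tensorProduct_quotient_iff, ← not_nontrivial_iff_subsingleton,
      ← mem_support_iff_nontrivial_residueField_tensorProduct, support_eq_zeroLocus]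
    rfl
  exact ⟨_, (key p).2 htop, fun q hq ↦
    (fiberRank_le_of_baseChange_eq_top q s ((key q).1 hq)).trans hs⟩

lemma fiberRank_mono [Module.Finite R M] : Monotone (fiberRank (R := R) M) := by
  intro p q hpq
  obtain ⟨I, hI, hle⟩ := exists_ideal_fiberRank_le (M := M) q
  exact hle p fun h ↦ hI (h.trans hpq)

lemma isClosed_le_fiberRank [Module.Finite R M] (j : ℕ) :
    IsClosed {p : PrimeSpectrum R | j ≤ fiberRank M p} := by
  rw [← isOpen_compl_iff, isOpen_iff_mem_nhds]
  intro p hp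
  obtain ⟨I, hI, hle⟩ := exists_ideal_fiberRank_le (M := M) p
  refine Filter.mem_of_superset
    ((PrimeSpectrum.isClosed_zeroLocus (I : Set R)).isOpen_compl.mem_nhds hI) fun q hq ↦ ?_
  exact fun h ↦ hp (le_trans h (hle q hq))

lemma exists_fiberRank_le [Module.Finite R M] :
    ∃ m, ∀ p : PrimeSpectrum R, fiberRank M p ≤ m := by
  obtain ⟨s, hs⟩ := Module.Finite.fg_top (R := R) (M := M)
  exact ⟨s.card, fun p ↦ fiberRank_le_of_baseChange_eq_top p s (by simp [hs])⟩

/-- The fiber rank takes each of its values at a generization from a finite set. -/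
lemma exists_finset_fiberRank_le [IsNoetherianRing R] [Module.Finite R M] :
    ∃ S : Finset (PrimeSpectrum R), ∀ p, ∃ q ∈ S, q ≤ p ∧ fiberRank M q = fiberRank M p := by
  classical
  have level (j : ℕ) : ∃ S : Finset (PrimeSpectrum R), ∀ p, j ≤ fiberRank M p →
      ∃ q ∈ S, q ≤ p ∧ j ≤ fiberRank M q := by
    obtain ⟨I, hI⟩ := (PrimeSpectrum.isClosed_iff_zeroLocus_ideal _).1
      (isClosed_le_fiberRank (R := R) (M := M) j)
    have hmem (p : PrimeSpectrum R) : j ≤ fiberRank M p ↔ I ≤ p.asIdeal :=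
      Set.ext_iff.1 hI p
    have hfin : {q : PrimeSpectrum R | q.asIdeal ∈ I.minimalPrimes}.Finite :=
      (I.finite_minimalPrimes_of_isNoetherianRing R).preimage
        fun _ _ _ _ h ↦ PrimeSpectrum.ext h
    refine ⟨hfin.toFinset, fun p hp ↦ ?_⟩
    obtain ⟨q, hq, hqp⟩ := Ideal.exists_minimalPrimes_le ((hmem p).1 hp)
    exact ⟨⟨q, hq.1.1⟩, by simpa using hq, hqp, (hmem ⟨q, hq.1.1⟩).2 hq.1.2⟩
  choose S hS using level
  obtain ⟨m, hm⟩ := exists_fiberRank_le (R := R) (M := M)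
  refine ⟨(Finset.range (m + 1)).biUnion S, fun p ↦ ?_⟩
  obtain ⟨q, hq, hqp, hle⟩ := hS _ p le_rfl
  exact ⟨q, Finset.mem_biUnion.2 ⟨_, Finset.mem_range.2 (Nat.lt_succ_of_le (hm p)), hq⟩, hqp,
    (fiberRank_mono hqp).antisymm hle⟩

lemma exists_tmul_ne_zero [Module.Finite R M] {p : PrimeSpectrum R} (hp : 0 < fiberRank M p) :
    ∃ x : M, (1 : p.asIdeal.ResidueField) ⊗ₜ[R] x ≠ 0 := by
  by_contra! h
  rw [fiberRank, finrank_pos_iff] at hp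
  refine not_subsingleton _ (subsingleton_of_forall_eq
    (0 : p.asIdeal.ResidueField ⊗[R] M) fun y ↦ ?_)
  induction y with
  | zero => rfl
  | tmul a m => rw [← mul_one a, ← smul_eq_mul, ← smul_tmul', h, smul_zero]
  | add y z hy hz => rw [hy, hz, add_zero]

/-- Prime avoidance for modules. -/
lemma exists_forall_tmul_ne_zero [Module.Finite R M] (S : Finset (PrimeSpectrum R))
    (hS : ∀ p ∈ S, 0 < fiberRank M p) :
    ∃ x : M, ∀ p ∈ S, (1 : p.asIdeal.ResidueField) ⊗ₜ[R] x ≠ 0 := by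
  classical
  induction S using Finset.strongInduction with
  | H S ih =>
    obtain rfl | hne := S.eq_empty_or_nonempty
    · exact ⟨0, by simp⟩
    obtain ⟨p, hp⟩ := S.exists_minimal hne
    obtain ⟨x, hx⟩ := ih (S.erase p) (Finset.erase_ssubset hp.1)
      fun q hq ↦ hS q (Finset.mem_of_mem_erase hq)
    by_cases hxp : (1 : p.asIdeal.ResidueField) ⊗ₜ[R] x = 0
    · obtain ⟨y, hy⟩ := exists_tmul_ne_zero (hS p hp.1)
      have hnot : ¬ (S.erase p).inf PrimeSpectrum.asIdeal ≤ p.asIdeal := by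
        rw [p.isPrime.inf_le']
        rintro ⟨q, hq, hqp⟩
        rw [Finset.mem_erase] at hq
        exact hq.1 (le_antisymm hqp (hp.2 hq.2 hqp))
      obtain ⟨a, ha, hap⟩ := SetLike.not_le_iff_exists.1 hnot
      have tmul_smul_eq (q : PrimeSpectrum R) : (1 : q.asIdeal.ResidueField) ⊗ₜ[R] (a • y) =
          algebraMap R q.asIdeal.ResidueField a • ((1 : q.asIdeal.ResidueField) ⊗ₜ[R] y) := by
        rw [tmul_smul, algebraMap_smul]
      refine ⟨x + a • y, fun q hq ↦ ?_⟩
      rw [tmul_add, tmul_smul_eq]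
      obtain rfl | hqp := eq_or_ne q p
      · rw [hxp, zero_add]
        exact smul_ne_zero (fun h ↦ hap (Ideal.algebraMap_residueField_eq_zero.1 h)) hy
      · have hq' : q ∈ S.erase p := Finset.mem_erase.2 ⟨hqp, hq⟩
        have haq : a ∈ q.asIdeal := Finset.inf_le (f := PrimeSpectrum.asIdeal) hq' ha
        rw [Ideal.algebraMap_residueField_eq_zero.2 haq, zero_smul, add_zero]
        exact hx q hq'
    · refine ⟨x, fun q hq ↦ ?_⟩
      obtain rfl | hqp := eq_or_ne q p
      · exact hxp
      · exact hx q (Finset.mem_erase.2 ⟨hqp, hq⟩)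

lemma fiberRank_quotient_le [Module.Finite R M] (N : Submodule R M) (p : PrimeSpectrum R) :
    fiberRank (M ⧸ N) p ≤ fiberRank M p :=
  LinearMap.finrank_le_finrank_of_surjective (f := N.mkQ.baseChange p.asIdeal.ResidueField)
    (N.mkQ.lTensor_surjective _ N.mkQ_surjective)

lemma fiberRank_quotient_lt [Module.Finite R M] {N : Submodule R M} {p : PrimeSpectrum R} {x : M}
    (hxN : x ∈ N) (hx : (1 : p.asIdeal.ResidueField) ⊗ₜ[R] x ≠ 0) :
    fiberRank (M ⧸ N) p < fiberRank M p := by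
  let f := N.mkQ.baseChange p.asIdeal.ResidueField
  have hsurj : Function.Surjective f := N.mkQ.lTensor_surjective _ N.mkQ_surjective
  have hker : 0 < finrank p.asIdeal.ResidueField (LinearMap.ker f) := by
    have hmem : (1 : p.asIdeal.ResidueField) ⊗ₜ[R] x ∈ LinearMap.ker f := by
      rw [LinearMap.mem_ker, LinearMap.baseChange_tmul, N.mkQ_apply,
        (Submodule.Quotient.mk_eq_zero N).2 hxN, tmul_zero]
    exact Submodule.one_le_finrank_iff.2 ((Submodule.ne_bot_iff _).2 ⟨_, hmem, hx⟩)
  have hadd := f.finrank_range_add_finrank_ker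
  rw [LinearMap.range_eq_top.2 hsurj, finrank_top] at hadd
  rw [fiberRank, fiberRank]
  omega

/-- A finite module over a Noetherian ring is generated by `m` elements as soon as
`fiberRank M p + dim R / p ≤ m` for all primes `p` in its support. -/
theorem exists_finset_span_eq_top_of_fiberRank_add_coheight_le {R : Type*} [CommRing R]
    [IsNoetherianRing R] (m : ℕ) (M : Type*) [AddCommGroup M] [Module R M] [Module.Finite R M]
    (h : ∀ p : PrimeSpectrum R, 0 < fiberRank M p → fiberRank M p + Order.coheight p ≤ m) :
    ∃ s : Finset M, s.card ≤ m ∧ Submodule.span R (s : Set M) = ⊤ := by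
  classical
  induction m generalizing M with
  | zero =>
    have : Subsingleton M := by
      rw [← support_eq_empty_iff (R := R), Set.eq_empty_iff_forall_notMem]
      intro p hp
      rw [← fiberRank_pos_iff] at hp
      have := le_self_add.trans (h p hp)
      norm_cast at this
      omega
    exact ⟨∅, by simp, Subsingleton.elim _ _⟩
  | succ m ih =>
    obtain ⟨S, hS⟩ := exists_finset_fiberRank_le (R := R) (M := M)
    obtain ⟨x, hx⟩ := exists_forall_tmul_ne_zero (M := M) (S.filter fun p ↦ 0 < fiberRank M p)
      fun p hp ↦ (Finset.mem_filter.1 hp).2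
    obtain ⟨t, ht, htop⟩ := ih (M ⧸ Submodule.span R {x}) fun p hp ↦ by
      have hle := fiberRank_quotient_le (Submodule.span R {x}) p
      obtain ⟨q, hqS, hqp, hq⟩ := hS p
      have hpos : 0 < fiberRank M p := hp.trans_le hle
      have hxq := hx q (Finset.mem_filter.2 ⟨hqS, hq ▸ hpos⟩)
      suffices hsucc : (fiberRank (M ⧸ Submodule.span R {x}) p + Order.coheight p) + 1 ≤
          (m : ℕ∞) + 1 from (ENat.add_le_add_iff_right ENat.one_ne_top).1 hsucc
      obtain rfl | hne := eq_or_ne q p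
      · have hlt := fiberRank_quotient_lt (Submodule.mem_span_singleton_self x) hxq
        calc _ = ((fiberRank (M ⧸ Submodule.span R {x}) q + 1 : ℕ) : ℕ∞) + Order.coheight q := by
              push_cast; ring
          _ ≤ fiberRank M q + Order.coheight q := by gcongr; exact hlt
          _ ≤ _ := by exact_mod_cast h q hpos
      · calc _ = (fiberRank (M ⧸ Submodule.span R {x}) p : ℕ∞) + (Order.coheight p + 1) := by ring
          _ ≤ fiberRank M q + Order.coheight q := by
              rw [hq]
              gcongr
              exact Order.coheight_add_one_le (lt_of_le_of_ne hqp hne)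
          _ ≤ _ := by exact_mod_cast h q (hq ▸ hpos)
    obtain ⟨g, hg⟩ := (Submodule.span R {x}).mkQ_surjective.hasRightInverse
    refine ⟨insert x (t.image g),
      (Finset.card_insert_le _ _).trans (Nat.succ_le_succ (Finset.card_image_le.trans ht)), ?_⟩
    rw [Finset.coe_insert, Submodule.span_insert, ← Submodule.comap_map_mkQ, Submodule.map_span,
      Finset.coe_image, ← Set.image_comp, hg.comp_eq_id, Set.image_id, htop, Submodule.comap_top]

lemma fiberRank_eq_finrank_of_algHom {p : PrimeSpectrum R} {K : Type*} [Field K] [Algebra R K]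
    (f : K →ₐ[R] p.asIdeal.ResidueField) : fiberRank M p = finrank K (K ⊗[R] M) := by
  let := f.toAlgebra
  have : IsScalarTower R K p.asIdeal.ResidueField := .of_algebraMap_eq' f.comp_algebraMap.symm
  rw [fiberRank, ← finrank_baseChange (R := p.asIdeal.ResidueField) (S := K),
    (AlgebraTensorModule.cancelBaseChange R K p.asIdeal.ResidueField
      p.asIdeal.ResidueField M).finrank_eq]

end Module

/-- Forster's theorem: over a Noetherian ring of Krull dimension d, a finite module that is
locally generated by n elements at every maximal ideal is generated by n + d elements. -/
theorem forster (R : Type) [CommRing R] [IsNoetherianRing R] (d n : ℕ)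
    (hd : ringKrullDim R = d)
    (M : Type) [AddCommGroup M] [Module R M] [Module.Finite R M]
    (h : ∀ (p : Ideal R), p.IsMaximal →
      ∃ s : Finset (FractionRing (R ⧸ p) ⊗[R] M), s.card ≤ n ∧
        Submodule.span (FractionRing (R ⧸ p)) (s : Set (FractionRing (R ⧸ p) ⊗[R] M)) = ⊤) :
    ∃ s : Finset M, s.card ≤ n + d ∧ Submodule.span R (s : Set M) = ⊤ := by
  refine Module.exists_finset_span_eq_top_of_fiberRank_add_coheight_le (n + d) M fun p _ ↦ ?_
  obtain ⟨I, hI, hpI⟩ := p.asIdeal.exists_le_maximal p.isPrime.ne_top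
  have hrank : Module.fiberRank M p ≤ n := by
    refine (Module.fiberRank_mono (M := M) (show p ≤ ⟨I, hI.isPrime⟩ from hpI)).trans ?_
    let e : FractionRing (R ⧸ I) ≃ₐ[R ⧸ I] I.ResidueField := IsLocalization.algEquiv
      (nonZeroDivisors (R ⧸ I)) _ _
    obtain ⟨s, hs, hspan⟩ := h I hI
    rw [Module.fiberRank_eq_finrank_of_algHom (p := ⟨I, hI.isPrime⟩)
      (e.restrictScalars R).toAlgHom, ← finrank_top, ← hspan]
    exact (finrank_span_finset_le_card s).trans hs
  have hcoheight : Order.coheight p ≤ d := by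
    have := Order.coheight_le_krullDim p
    rw [← ringKrullDim, hd] at this
    exact_mod_cast this
  push_cast
  gcongr
end

section
/- Let R be a commutative Noetherian ring with 1 such that dim Max R = d and R/p is infinite for every maximal ideal p. Then every finite étale R-algebra A of rank n can be generated by d + 1 elements as a non-unital R-algebra. -/
open TensorProduct

/-- `s` generates `A` as a non-unital (non-associative) `R`-algebra: every `R`-submodule of `A`
containing `s` and closed under multiplication is all of `A` (equivalently, the smallest such
submodule is `⊤`). -/
def GeneratesAsNonUnitalAlgebra (R : Type*) {A : Type*} [CommSemiring R]
    [NonUnitalNonAssocSemiring A] [Module R A] (s : Set A) : Prop :=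
  ∀ B : Submodule R A, s ⊆ (B : Set A) → (∀ x ∈ B, ∀ y ∈ B, x * y ∈ B) → B = ⊤

open TopologicalSpace

section Dimension

variable {X : Type*} [TopologicalSpace X]

/-- Every chain of irreducible closed subsets of `X` contained in `Z` has length less than `m`. -/
def ChainLengthLT (Z : Set X) (m : ℕ) : Prop :=
  ∀ c : LTSeries (IrreducibleCloseds X), (c.last : Set X) ⊆ Z → c.length < m

theorem chainLengthLT_of_topologicalKrullDim_eq {d : ℕ} (hd : topologicalKrullDim X = d)
    (Z : Set X) : ChainLengthLT Z (d + 1) := fun c _ ↦ by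
  have h := Order.LTSeries.length_le_krullDim c
  rw [topologicalKrullDim] at hd
  rw [hd] at h
  exact Nat.lt_succ_of_le (by exact_mod_cast h)

theorem ChainLengthLT.eq_empty [T1Space X] {Z : Set X} (h : ChainLengthLT Z 0) : Z = ∅ := by
  by_contra! hne
  obtain ⟨x, hx⟩ := hne
  refine Nat.not_lt_zero _ (h (RelSeries.singleton _ ⟨{x}, isIrreducible_singleton,
    isClosed_singleton⟩) ?_)
  simpa using hx

/-- For a closed set in a Noetherian space there are finitely many points such that every subset
avoiding them has smaller dimension. -/
theorem ChainLengthLT.exists_finset [NoetherianSpace X] {Z : Set X} (hZ : IsClosed Z) {m : ℕ}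
    (h : ChainLengthLT Z (m + 1)) :
    ∃ T : Finset X, ∀ Z' ⊆ Z, (∀ x ∈ T, x ∉ Z') → ChainLengthLT Z' m := by
  classical
  obtain ⟨S, hS, hclosed, hirr, hsup⟩ :=
    NoetherianSpace.exists_finite_set_isClosed_irreducible hZ
  lift S to Finset (Set X) using hS
  choose x hx using fun t : S ↦ (hirr t t.2).nonempty
  refine ⟨Finset.univ.image x, fun Z' hZ' hT c hc ↦ ?_⟩
  obtain ⟨t, ht, hct⟩ := isIrreducible_iff_sUnion_isClosed.1 c.last.isIrreducible S hclosed
    (hsup ▸ hc.trans hZ')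
  have hlt : c.last < ⟨t, hirr t ht, hclosed t ht⟩ :=
    lt_of_le_of_ne hct fun heq ↦ hT (x ⟨t, ht⟩) (Finset.mem_image_of_mem x (Finset.mem_univ _))
      (hc (heq ▸ hx ⟨t, ht⟩))
  have := h (c.snoc _ hlt) <| by
    rw [RelSeries.last_snoc, hsup]
    exact Set.subset_sUnion_of_mem ht
  simpa using this

end Dimension

section Field

variable {k L E : Type*} [Field k] [Field L] [Algebra k L]

/-- Positive powers of a vector with distinct nonzero coordinates are linearly independent. -/
theorem linearIndependent_pow_succ {n : ℕ} {v : Fin n → L} (hv : Function.Injective v)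
    (hv0 : ∀ i, v i ≠ 0) : LinearIndependent L fun j : Fin n ↦ v ^ (j.1 + 1) := by
  have hdet : (Matrix.of fun j i : Fin n ↦ v i ^ (j.1 + 1)).det ≠ 0 := by
    have : (Matrix.of fun j i : Fin n ↦ v i ^ (j.1 + 1)) =
        Matrix.of fun j i ↦ v i * (Matrix.vandermonde v).transpose j i := by
      ext j i
      simp [Matrix.vandermonde_apply, pow_succ']
    rw [this, Matrix.det_mul_row, Matrix.det_transpose]
    exact mul_ne_zero (Finset.prod_ne_zero_iff.2 fun i _ ↦ hv0 i)
      (Matrix.det_vandermonde_ne_zero_iff.2 hv)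
  exact Matrix.linearIndependent_rows_iff_isUnit.2
    ((Matrix.isUnit_iff_isUnit_det _).2 hdet.isUnit)

variable [CommRing E] [Algebra k E]

theorem exists_span_pow_succ_eq_top [Infinite k] [Module.Finite k E] {n : ℕ}
    (e : L ⊗[k] E ≃ₐ[L] (Fin n → L)) :
    ∃ a : E, Submodule.span k (Set.range fun j : Fin n ↦ a ^ (j.1 + 1)) = ⊤ := by
  classical
  let φ : E →ₐ[k] (Fin n → L) :=
    (e.toAlgHom.restrictScalars k).comp Algebra.TensorProduct.includeRight
  have hext : ∀ f : (Fin n → L) →ₗ[L] L, (∀ a, f (φ a) = 0) → f = 0 := by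
    intro f hf
    have : f ∘ₗ e.toLinearMap = 0 := by
      refine TensorProduct.AlgebraTensorModule.curry_injective ?_
      ext a
      simpa [φ] using hf a
    ext1 i
    ext
    simpa using LinearMap.congr_fun this (e.symm (Pi.single i 1))
  let p : Fin n ⊕ {x : Fin n × Fin n // x.1 ≠ x.2} → Subspace k E := Sum.elim
    (fun i ↦ LinearMap.ker ((LinearMap.proj i : (Fin n → L) →ₗ[k] L) ∘ₗ φ.toLinearMap))
    (fun x ↦ LinearMap.ker (((LinearMap.proj x.1.1 : (Fin n → L) →ₗ[k] L) -
      LinearMap.proj x.1.2) ∘ₗ φ.toLinearMap))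
  have hp : ∀ i, p i ≠ ⊤ := by
    rintro (i | ⟨⟨i, j⟩, hij⟩) h
    · have := hext (LinearMap.proj i) fun a ↦ by
        have : a ∈ p (.inl i) := h ▸ Submodule.mem_top
        simpa [p] using this
      simpa using LinearMap.congr_fun this (Pi.single i 1)
    · have := hext ((LinearMap.proj i : (Fin n → L) →ₗ[L] L) - LinearMap.proj j) fun a ↦ by
        have : a ∈ p (.inr ⟨⟨i, j⟩, hij⟩) := h ▸ Submodule.mem_top
        simpa [p] using this
      have := LinearMap.congr_fun this (Pi.single i 1)
      simp [Pi.single_eq_of_ne (Ne.symm hij)] at this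
  obtain ⟨a, ha⟩ : ∃ a, ∀ i, a ∉ p i := by
    by_contra! hcon
    obtain ⟨i, hi⟩ := Subspace.exists_eq_top_of_iUnion_eq_univ (p := p)
      (Set.eq_univ_of_forall fun a ↦ Set.mem_iUnion.2 (hcon a))
    exact hp i hi
  refine ⟨a, LinearIndependent.span_eq_top_of_card_eq_finrank' ?_ ?_⟩
  · have hli : LinearIndependent L fun j : Fin n ↦ φ a ^ (j.1 + 1) := by
      refine linearIndependent_pow_succ (fun i j hij ↦ ?_) fun i hi ↦ ha (.inl i) ?_
      · by_contra hne
        exact ha (.inr ⟨⟨i, j⟩, hne⟩) (by simpa [p, sub_eq_zero] using hij)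
      · simpa [p] using hi
    have hli := hli.restrict_scalars (R := k) (by
      simpa [Algebra.smul_def] using (algebraMap k L).injective)
    refine LinearIndependent.of_comp φ.toLinearMap ?_
    simpa [Function.comp_def] using hli
  · rw [← Module.finrank_baseChange (R := L), e.toLinearEquiv.finrank_eq]
    simp

end Field

section Fibre

variable {R A S : Type*} [CommRing R] [CommRing A] [Algebra R A]
  [CommRing S] [Algebra R S]

theorem exists_span_pow_succ_sup_smul_top_eq_top [Module.Finite R A]
    [Module.FaithfullyFlat R S] {n : ℕ}
    (e : S ⊗[R] A ≃ₐ[S] (Fin n → S)) (p : Ideal R) [p.IsMaximal] [Infinite (R ⧸ p)] :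
    ∃ a : A, Submodule.span R (Set.range fun j : Fin n ↦ a ^ (j.1 + 1)) ⊔
      p • (⊤ : Submodule R A) = ⊤ := by
  let := Ideal.Quotient.field p
  obtain ⟨m, hm, hpm⟩ : ∃ m : Ideal S, m.IsMaximal ∧ p ≤ m.comap (algebraMap R S) := by
    have hne : p.map (algebraMap R S) ≠ ⊤ := fun h ↦ by
      have := Ideal.comap_map_eq_self_of_faithfullyFlat (B := S) p
      rw [h, Ideal.comap_top] at this
      exact Ideal.IsPrime.ne_top' this.symm
    obtain ⟨m, hm, hle⟩ := Ideal.exists_le_maximal _ hne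
    exact ⟨m, hm, Ideal.map_le_iff_le_comap.1 hle⟩
  let := Ideal.Quotient.field m
  let : Algebra (R ⧸ p) (S ⧸ m) := (Ideal.quotientMap m (algebraMap R S) hpm).toAlgebra
  have : IsScalarTower R (R ⧸ p) (S ⧸ m) := .of_algebraMap_eq fun _ ↦ rfl
  let e' : (S ⧸ m) ⊗[R ⧸ p] ((R ⧸ p) ⊗[R] A) ≃ₐ[S ⧸ m] (Fin n → S ⧸ m) :=
    (Algebra.TensorProduct.cancelBaseChange R (R ⧸ p) (S ⧸ m) (S ⧸ m) A).trans <|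
    (Algebra.TensorProduct.cancelBaseChange R S (S ⧸ m) (S ⧸ m) A).symm.trans <|
    (Algebra.TensorProduct.congr AlgEquiv.refl e).trans <|
    Algebra.TensorProduct.piScalarRight S (S ⧸ m) (S ⧸ m) (Fin n)
  obtain ⟨b, hb⟩ := exists_span_pow_succ_eq_top e'
  let ψ : A →ₐ[R] (R ⧸ p) ⊗[R] A := Algebra.TensorProduct.includeRight
  have hψ : ψ.toLinearMap =
      (TensorProduct.quotTensorEquivQuotSMul A p).symm.toLinearMap ∘ₗ
        (p • (⊤ : Submodule R A)).mkQ := by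
    ext a
    simp [ψ]
  have hker : LinearMap.ker ψ.toLinearMap = p • ⊤ := by
    rw [hψ, LinearEquiv.ker_comp, Submodule.ker_mkQ]
  have hsurj : Function.Surjective ψ.toLinearMap := by
    rw [hψ]
    exact (TensorProduct.quotTensorEquivQuotSMul A p).symm.surjective.comp
      (Submodule.mkQ_surjective _)
  obtain ⟨a, rfl⟩ := hsurj b
  refine ⟨a, ?_⟩
  rw [← hker, ← Submodule.comap_map_eq, Submodule.map_span]
  have hspan := Submodule.restrictScalars_span R (R ⧸ p) Ideal.Quotient.mk_surjective
    (Set.range fun j : Fin n ↦ ψ.toLinearMap a ^ (j.1 + 1))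
  rw [hb, Submodule.restrictScalars_top] at hspan
  rw [← Set.range_comp]
  simp only [Function.comp_def, AlgHom.toLinearMap_apply, map_pow] at hspan ⊢
  rw [← hspan, Submodule.comap_top]

theorem exists_forall_sub_mem_smul_top (T : Finset (MaximalSpectrum R))
    (b : MaximalSpectrum R → A) :
    ∃ a : A, ∀ p ∈ T, a - b p ∈ p.asIdeal • (⊤ : Submodule R A) := by
  classical
  have hcop : Pairwise (Function.onFun IsCoprime fun p : T ↦ p.1.asIdeal) := fun p q hpq ↦
    Ideal.isCoprime_iff_sup_eq.2 <| p.1.isMaximal.coprime_of_ne q.1.isMaximal fun h ↦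
      hpq (Subtype.ext (MaximalSpectrum.ext h))
  choose r hr using fun p : T ↦ Ideal.exists_forall_sub_mem_ideal hcop (Pi.single p 1)
  refine ⟨∑ q, r q • b q, fun p hp ↦ ?_⟩
  have : ∑ q, r q • b q - b p = ∑ q, (r q - Pi.single (M := fun _ ↦ R) q 1 ⟨p, hp⟩) • b q := by
    simp [sub_smul, Pi.single_apply]
  rw [this]
  exact Submodule.sum_mem _ fun q _ ↦ Submodule.smul_mem_smul (hr q ⟨p, hp⟩) Submodule.mem_top

theorem exists_forall_not_colon_le [Module.Finite R A] [Module.FaithfullyFlat R S] {n : ℕ}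
    (e : S ⊗[R] A ≃ₐ[S] (Fin n → S)) (hres : ∀ p : Ideal R, p.IsMaximal → Infinite (R ⧸ p))
    (T : Finset (MaximalSpectrum R)) :
    ∃ a : A, ∀ p ∈ T, ¬ (Submodule.span R (Set.range fun j : Fin n ↦ a ^ (j.1 + 1))).colon
      Set.univ ≤ p.asIdeal := by
  choose b hb using fun p : MaximalSpectrum R ↦
    have := p.isMaximal
    have := hres p.asIdeal p.isMaximal
    exists_span_pow_succ_sup_smul_top_eq_top e p.asIdeal
  obtain ⟨a, ha⟩ := exists_forall_sub_mem_smul_top T b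
  refine ⟨a, fun p hp hle ↦ p.isMaximal.ne_top ?_⟩
  set N := Submodule.span R (Set.range fun j : Fin n ↦ a ^ (j.1 + 1))
  have htop : (⊤ : Submodule R A) ≤ N ⊔ p.asIdeal • (⊤ : Submodule R A) := by
    refine (hb p).ge.trans (sup_le (Submodule.span_le.2 ?_) le_sup_right)
    rintro _ ⟨j, rfl⟩
    have hmem : a ^ (j.1 + 1) - b p ^ (j.1 + 1) ∈ p.asIdeal • (⊤ : Submodule R A) := by
      have hap := ha p hp
      rw [Ideal.smul_top_eq_map] at hap ⊢
      exact Ideal.mem_of_dvd _ (sub_dvd_pow_sub_pow _ _ _) hap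
    beta_reduce
    rw [SetLike.mem_coe, ← sub_sub_cancel (a ^ (j.1 + 1)) (b p ^ (j.1 + 1))]
    exact sub_mem (Submodule.mem_sup_left (Submodule.subset_span ⟨j, rfl⟩))
      (Submodule.mem_sup_right hmem)
  obtain ⟨r, hr, hrN⟩ := Submodule.exists_sub_one_mem_and_smul_le_of_fg_of_le_sup
    Module.Finite.fg_top le_top htop
  have hrp : r ∈ p.asIdeal := hle <| Submodule.mem_colon.2 fun x _ ↦
    hrN (Submodule.smul_mem_pointwise_smul x r ⊤ Submodule.mem_top)
  rw [Ideal.eq_top_iff_one]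
  simpa using sub_mem hrp hr

end Fibre

theorem exists_finset_forall_not_colon_le {R A S : Type*} [CommRing R] [IsNoetherianRing R]
    [CommRing A] [Algebra R A] [Module.Finite R A] [CommRing S] [Algebra R S]
    [Module.FaithfullyFlat R S] {n : ℕ} (e : S ⊗[R] A ≃ₐ[S] (Fin n → S))
    (hres : ∀ p : Ideal R, p.IsMaximal → Infinite (R ⧸ p)) (m : ℕ) (I : Ideal R)
    (hI : ChainLengthLT (MaximalSpectrum.toPrimeSpectrum ⁻¹' PrimeSpectrum.zeroLocus (I : Set R))
      m) :
    ∃ s : Finset A, s.card ≤ m ∧ ∀ B : Submodule R A, (s : Set A) ⊆ B →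
      (∀ x ∈ B, ∀ y ∈ B, x * y ∈ B) →
      ∀ p : MaximalSpectrum R, I ≤ p.asIdeal → ¬ B.colon Set.univ ≤ p.asIdeal := by
  classical
  have hnoeth : NoetherianSpace (MaximalSpectrum R) :=
    Topology.IsInducing.noetherianSpace (i := MaximalSpectrum.toPrimeSpectrum) ⟨rfl⟩
  induction m generalizing I with
  | zero =>
    refine ⟨∅, le_rfl, fun B _ _ p hp ↦ ?_⟩
    exact (Set.eq_empty_iff_forall_notMem.1 hI.eq_empty p hp).elim
  | succ m ih =>
    obtain ⟨T, hT⟩ := hI.exists_finset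
      ((PrimeSpectrum.isClosed_zeroLocus _).preimage MaximalSpectrum.toPrimeSpectrum_continuous)
    obtain ⟨a, ha⟩ := exists_forall_not_colon_le e hres T
    set N := Submodule.span R (Set.range fun j : Fin n ↦ a ^ (j.1 + 1))
    obtain ⟨s, hcard, hs⟩ := ih (I ⊔ N.colon Set.univ) <| hT _
      (fun p (hp : _ ≤ p.asIdeal) ↦ show I ≤ p.asIdeal from le_sup_left.trans hp)
      fun p hp (hpN : _ ≤ p.asIdeal) ↦ ha p hp (le_sup_right.trans hpN)
    refine ⟨insert a s, (Finset.card_insert_le _ _).trans (by lia), fun B hsB hB p hp hle ↦ ?_⟩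
    rw [Finset.coe_insert, Set.insert_subset_iff] at hsB
    have hNB : N ≤ B := by
      refine Submodule.span_le.2 ?_
      rintro _ ⟨⟨j, hj⟩, rfl⟩
      change a ^ (j + 1) ∈ B
      clear hj
      induction j with
      | zero => simpa using hsB.1
      | succ i hi => exact pow_succ a (i + 1) ▸ hB _ hi _ hsB.1
    exact hs B hsB.2 hB p (sup_le hp ((Submodule.colon_mono hNB le_rfl).trans hle)) hle

theorem etale_algebra_generators (R : Type) [CommRing R] [IsNoetherianRing R] (d n : ℕ)
    (hd : topologicalKrullDim (MaximalSpectrum R) = d)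
    (hres : ∀ (p : Ideal R), p.IsMaximal → Infinite (R ⧸ p))
    (A : Type) [CommRing A] [Algebra R A] [Module.Finite R A]
    (S : Type) [CommRing S] [Algebra R S] (hS : Module.FaithfullyFlat R S)
    (hform : Nonempty ((S ⊗[R] A) ≃ₐ[S] (Fin n → S))) :
    ∃ s : Finset A, s.card ≤ d + 1 ∧ GeneratesAsNonUnitalAlgebra R (s : Set A) := by
  obtain ⟨e⟩ := hform
  obtain ⟨s, hcard, hs⟩ := exists_finset_forall_not_colon_le e hres (d + 1) ⊥
    (chainLengthLT_of_topologicalKrullDim_eq hd _)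
  refine ⟨s, hcard, fun B hsB hB ↦ ?_⟩
  by_contra hne
  have hcolon : B.colon Set.univ ≠ ⊤ := fun h ↦ hne <| by
    rwa [Submodule.colon_eq_top_iff_subset, Set.univ_subset_iff, Submodule.coe_eq_univ] at h
  obtain ⟨p, hp, hle⟩ := Ideal.exists_le_maximal _ hcolon
  exact hs B hsB hB ⟨p, hp⟩ bot_le hle
end

section
/- Let R be a commutative Noetherian ring with 1 with dim Max R = d. Then every Azumaya R-algebra (a form of the matrix algebra Mat_n(R) under a faithfully flat base change) can be generated by d + 2 elements as a non-unital R-algebra. -/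
open TensorProduct

open TopologicalSpace in
/-- In a Noetherian space with a decreasing sequence of closed sets `Z t`, eventually empty, there is
a finite set of test points such that shrinking each `Z t` to a closed subset which avoids the test
points of `Z t \ Z (t + 1)` improves the dimension bound `dim (Z t) + t < c + 1` to
`dim (Z t) + t < c`. -/
theorem exists_finite_height_add_le {X : Type*} [TopologicalSpace X] [NoetherianSpace X]
    (Z : ℕ → Set X) (hcl : ∀ t, IsClosed (Z t)) (hanti : Antitone Z) (r : ℕ) (hr : Z r = ∅) (c : ℕ)
    (hZ : ∀ t, ∀ Y : IrreducibleCloseds X, (Y : Set X) ⊆ Z t → Order.height Y + t + 1 ≤ c + 1) :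
    ∃ F : Finset X, ∀ W : ℕ → Set X, (∀ t, W t ⊆ Z t) → (∀ t, IsClosed (W t)) →
      (∀ x ∈ F, ∀ t, x ∈ Z t → x ∉ Z (t + 1) → x ∉ W t) →
      ∀ t, ∀ Y : IrreducibleCloseds X, (Y : Set X) ⊆ W t → Order.height Y + t + 1 ≤ c := by
  classical
  choose S hSfin hScl hSirr hSU using
    fun t ↦ NoetherianSpace.exists_finite_set_isClosed_irreducible (hcl t)
  have key (t : ℕ) : ∃ F : Finset X, ∀ C ∈ S t, ¬ C ⊆ Z (t + 1) → ∃ x ∈ F, x ∈ C ∧ x ∉ Z (t + 1) := by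
    have (C : Set X) (h : ¬ C ⊆ Z (t + 1)) : ∃ x, x ∈ C ∧ x ∉ Z (t + 1) := Set.not_subset.mp h
    choose f hf using this
    refine ⟨(hSfin t).toFinset.biUnion fun C ↦ if h : ¬ C ⊆ Z (t + 1) then {f C h} else ∅, ?_⟩
    intro C hC h
    refine ⟨f C h, ?_, hf C h⟩
    simp only [Finset.mem_biUnion, Set.Finite.mem_toFinset]
    exact ⟨C, hC, by rw [dif_pos h]; simp⟩
  choose F hF using key
  refine ⟨(Finset.range r).biUnion F, fun W hWZ hWcl hW t Y hY ↦ ?_⟩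
  have hsub : (Y : Set X) ⊆ ⋃₀ ((hSfin t).toFinset : Set (Set X)) := by
    rw [Set.Finite.coe_toFinset, ← hSU t]
    exact hY.trans (hWZ t)
  have htr : t < r := by
    by_contra! h
    obtain ⟨y, hy⟩ := Y.isIrreducible.nonempty
    simpa [hr] using hanti h (hWZ t (hY hy))
  obtain ⟨C, hC, hYC⟩ := isIrreducible_iff_sUnion_isClosed.1 Y.isIrreducible (hSfin t).toFinset
    (fun z hz ↦ hScl t z (by simpa using hz)) hsub
  rw [Set.Finite.mem_toFinset] at hC
  let C' : IrreducibleCloseds X := ⟨C, hSirr t C hC, hScl t C hC⟩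
  have hCZ : C ⊆ Z t := by rw [hSU t]; exact Set.subset_sUnion_of_mem hC
  have hle : Y ≤ C' := hYC
  rw [← ENat.add_le_add_iff_right (k := 1) (by simp)]
  by_cases h : C ⊆ Z (t + 1)
  · have h1 := hZ (t + 1) C' h
    refine le_trans ?_ h1
    push_cast
    rw [← add_assoc]
    gcongr
  · obtain ⟨x, hxF, hxC, hxZ⟩ := hF t C hC h
    have hxW := hW x (Finset.mem_biUnion.mpr ⟨t, Finset.mem_range.mpr htr, hxF⟩) t (hCZ hxC) hxZ
    have hlt : Y < C' := lt_of_le_of_ne hle fun e ↦ hxW (hY (e ▸ hxC : x ∈ Y))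
    refine le_trans ?_ (hZ t C' hCZ)
    rw [add_right_comm _ (t : ℕ∞) 1]
    gcongr
    exact Order.height_add_one_le hlt

instance {R : Type*} [CommRing R] [IsNoetherianRing R] :
    TopologicalSpace.NoetherianSpace (MaximalSpectrum R) :=
  Topology.IsInducing.noetherianSpace (i := MaximalSpectrum.toPrimeSpectrum) ⟨rfl⟩

section Generation

variable {R A : Type*} [CommRing R] [NonUnitalNonAssocRing A] [Module R A]

/-- Elements of `A` with prescribed residues modulo finitely many maximal ideals exist. -/
theorem exists_forall_sub_mem_maximalIdeal_smul_top {R M : Type*} [CommRing R] [AddCommGroup M]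
    [Module R M] (F : Finset (MaximalSpectrum R)) (a : MaximalSpectrum R → M) :
    ∃ x : M, ∀ m ∈ F, x - a m ∈ m.asIdeal • (⊤ : Submodule R M) := by
  classical
  have hcop : Pairwise (Function.onFun IsCoprime fun m : F ↦ m.1.asIdeal) := fun m m' h ↦
    Ideal.isCoprime_of_isMaximal fun e ↦ h (Subtype.ext (MaximalSpectrum.ext e))
  choose e he using fun m : F ↦ Ideal.exists_forall_sub_mem_ideal hcop (Pi.single m 1)
  refine ⟨∑ m : F, e m • a m, fun m hm ↦ ?_⟩
  rw [← Finset.add_sum_erase _ _ (Finset.mem_univ (⟨m, hm⟩ : F)), add_sub_right_comm]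
  refine add_mem ?_ (sum_mem fun m' hm' ↦ ?_)
  · have := he ⟨m, hm⟩ ⟨m, hm⟩
    rw [Pi.single_eq_same] at this
    simpa [sub_smul] using Submodule.smul_mem_smul this (Submodule.mem_top (x := a m))
  · have := he m' ⟨m, hm⟩
    rw [Pi.single_eq_of_ne (Finset.ne_of_mem_erase hm').symm, sub_zero] at this
    exact Submodule.smul_mem_smul this Submodule.mem_top

variable [IsScalarTower R A A] [SMulCommClass R A A]

/-- `s` generates `A / IA` as a non-unital `R`-algebra. -/
def GeneratesModulo (I : Ideal R) (s : Set A) : Prop :=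
  (NonUnitalAlgebra.adjoin R s).toSubmodule ⊔ I • ⊤ = ⊤

/-- `A / IA` is generated as a non-unital `R`-algebra by `s` and `t` further elements. -/
def GeneratesModuloWith (t : ℕ) (I : Ideal R) (s : Set A) : Prop :=
  ∃ b : Finset A, b.card ≤ t ∧ GeneratesModulo I (s ∪ b)

theorem GeneratesModulo.mono {I : Ideal R} {s s' : Set A} (h : GeneratesModulo I s) (hs : s ⊆ s') :
    GeneratesModulo I s' :=
  top_unique <| h.ge.trans <| sup_le_sup_right (NonUnitalAlgebra.adjoin_mono hs) _

theorem GeneratesModulo.of_insert_sub_mem {I : Ideal R} {s : Set A} {x y : A}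
    (h : GeneratesModulo I (insert y s)) (hxy : x - y ∈ I • (⊤ : Submodule R A)) :
    GeneratesModulo I (insert x s) := by
  set N := (NonUnitalAlgebra.adjoin R (insert x s)).toSubmodule
  have hmulI {u v : A} (h : u ∈ I • (⊤ : Submodule R A) ∨ v ∈ I • (⊤ : Submodule R A)) :
      u * v ∈ I • (⊤ : Submodule R A) := by
    rcases h with h | h
    · induction h using Submodule.smul_induction_on' with
      | smul r hr a _ =>
        rw [smul_mul_assoc]
        exact Submodule.smul_mem_smul hr Submodule.mem_top
      | add a _ b _ ha hb => rw [add_mul]; exact add_mem ha hb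
    · induction h using Submodule.smul_induction_on' with
      | smul r hr a _ =>
        rw [mul_smul_comm]
        exact Submodule.smul_mem_smul hr Submodule.mem_top
      | add a _ b _ ha hb => rw [mul_add]; exact add_mem ha hb
  let B : NonUnitalSubalgebra R A :=
    { N ⊔ I • ⊤ with
      mul_mem' := by
        intro u v hu hv
        obtain ⟨u₁, hu₁, u₂, hu₂, rfl⟩ := Submodule.mem_sup.mp hu
        obtain ⟨v₁, hv₁, v₂, hv₂, rfl⟩ := Submodule.mem_sup.mp hv
        rw [mul_add, add_mul, add_assoc]
        exact add_mem (Submodule.mem_sup_left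
          (mul_mem (S := NonUnitalSubalgebra R A) hu₁ hv₁))
          (Submodule.mem_sup_right (add_mem (hmulI (.inl hu₂)) (hmulI (.inr hv₂)))) }
  have hx : x ∈ N := NonUnitalAlgebra.subset_adjoin R (Set.mem_insert x s)
  have hB : NonUnitalAlgebra.adjoin R (insert y s) ≤ B := by
    refine NonUnitalAlgebra.adjoin_le (Set.insert_subset ?_ fun z hz ↦ ?_)
    · have := Submodule.sub_mem (N ⊔ I • ⊤) (Submodule.mem_sup_left hx) (Submodule.mem_sup_right hxy)
      rwa [sub_sub_cancel] at this
    · exact Submodule.mem_sup_left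
        (NonUnitalAlgebra.subset_adjoin R (Set.mem_insert_of_mem x hz) : z ∈ N)
  exact top_unique <| h.ge.trans <| sup_le (c := N ⊔ I • ⊤) hB le_sup_right

theorem GeneratesModuloWith.mono {I : Ideal R} {s s' : Set A} {t t' : ℕ}
    (h : GeneratesModuloWith t I s) (hs : s ⊆ s') (ht : t ≤ t') : GeneratesModuloWith t' I s' :=
  let ⟨b, hb, hg⟩ := h
  ⟨b, hb.trans ht, hg.mono (Set.union_subset_union_left _ hs)⟩

theorem GeneratesModuloWith.exists_insert {I : Ideal R} {s : Set A} {t : ℕ}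
    (h : GeneratesModuloWith (t + 1) I s) (h' : ¬ GeneratesModuloWith t I s) :
    ∃ y : A, ∀ x : A, x - y ∈ I • (⊤ : Submodule R A) → GeneratesModuloWith t I (insert x s) := by
  classical
  obtain ⟨b, hb, hg⟩ := h
  obtain ⟨y, b', hy, rfl, hb'⟩ := Finset.card_eq_succ.mp <|
    le_antisymm hb (Nat.succ_le_of_lt (not_le.mp fun hle ↦ h' ⟨b, hle, hg⟩))
  refine ⟨y, fun x hx ↦ ⟨b', hb'.le, ?_⟩⟩
  rw [Finset.coe_insert, Set.union_insert] at hg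
  rw [Set.insert_union]
  exact hg.of_insert_sub_mem hx

variable [Module.Finite R A]

theorem GeneratesModulo.exists_smul_mem {I : Ideal R} {s : Set A} (h : GeneratesModulo I s) :
    ∃ r : R, r - 1 ∈ I ∧ ∀ x : A, r • x ∈ NonUnitalAlgebra.adjoin R s := by
  obtain ⟨r, hr, hN⟩ := Submodule.exists_sub_one_mem_and_smul_le_of_fg_of_le_sup
    (Module.Finite.fg_top (R := R) (M := A)) le_rfl h.ge
  exact ⟨r, hr, fun x ↦ hN (Submodule.smul_mem_pointwise_smul x r ⊤ Submodule.mem_top)⟩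

theorem isOpen_generatesModulo (s : Set A) :
    IsOpen {m : MaximalSpectrum R | GeneratesModulo m.asIdeal s} := by
  rw [isOpen_iff_forall_mem_open]
  intro m hm
  obtain ⟨r, hr, hN⟩ := hm.exists_smul_mem
  refine ⟨MaximalSpectrum.toPrimeSpectrum ⁻¹' PrimeSpectrum.basicOpen r, fun m' hm' ↦ ?_,
    (PrimeSpectrum.basicOpen r).isOpen.preimage MaximalSpectrum.toPrimeSpectrum_continuous,
    fun h ↦ m.isMaximal.ne_top ?_⟩
  · obtain ⟨u, v, hv, huv⟩ := m'.isMaximal.exists_inv hm'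
    refine Submodule.eq_top_iff'.mpr fun x ↦ ?_
    rw [← one_smul R x, ← huv, add_smul, mul_smul]
    exact add_mem (Submodule.mem_sup_left (Submodule.smul_mem _ u (hN x)))
      (Submodule.mem_sup_right (Submodule.smul_mem_smul hv Submodule.mem_top))
  · rw [Ideal.eq_top_iff_one]
    simpa using sub_mem (show r ∈ m.asIdeal from h) hr

theorem isClosed_not_generatesModuloWith (t : ℕ) (s : Set A) :
    IsClosed {m : MaximalSpectrum R | ¬ GeneratesModuloWith t m.asIdeal s} := by
  rw [← isOpen_compl_iff]
  have : {m : MaximalSpectrum R | ¬ GeneratesModuloWith t m.asIdeal s}ᶜ =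
      ⋃ b : {b : Finset A // b.card ≤ t},
        {m : MaximalSpectrum R | GeneratesModulo m.asIdeal (s ∪ b.1)} := by
    ext m
    simp [GeneratesModuloWith]
  rw [this]
  exact isOpen_iUnion fun b ↦ isOpen_generatesModulo _

theorem adjoin_eq_top_of_generatesModulo {s : Set A}
    (h : ∀ m : MaximalSpectrum R, GeneratesModulo m.asIdeal s) :
    NonUnitalAlgebra.adjoin R s = ⊤ := by
  let J : Ideal R := (NonUnitalAlgebra.adjoin R s).toSubmodule.colon Set.univ
  have hJ : J = ⊤ := by
    by_contra hne
    obtain ⟨m, hm, hle⟩ := Ideal.exists_le_maximal J hne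
    obtain ⟨r, hr, hN⟩ := (h ⟨m, hm⟩).exists_smul_mem
    refine hm.ne_top ((Ideal.eq_top_iff_one m).mpr ?_)
    have : r ∈ m := hle (Submodule.mem_colon.mpr fun x _ ↦ hN x)
    simpa using sub_mem this hr
  refine eq_top_iff.mpr fun x _ ↦ ?_
  have := Submodule.mem_colon.mp ((Ideal.eq_top_iff_one J).mp hJ) x (Set.mem_univ x)
  rwa [one_smul] at this

theorem exists_generatesModulo_of_height_add_le [IsNoetherianRing R] (r c : ℕ) (s : Set A)
    (hr : ∀ m : MaximalSpectrum R, GeneratesModuloWith r m.asIdeal s)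
    (hdim : ∀ t, ∀ Y : TopologicalSpace.IrreducibleCloseds (MaximalSpectrum R),
      (Y : Set (MaximalSpectrum R)) ⊆ {m | ¬ GeneratesModuloWith t m.asIdeal s} →
      Order.height Y + t + 1 ≤ c) :
    ∃ b : Finset A, b.card ≤ c ∧ ∀ m : MaximalSpectrum R, GeneratesModulo m.asIdeal (s ∪ b) := by
  classical
  induction c generalizing s with
  | zero =>
    refine ⟨∅, le_rfl, fun m ↦ ?_⟩
    have h0 : GeneratesModuloWith 0 m.asIdeal s := by
      by_contra h
      have := hdim 0 ⟨{m}, isIrreducible_singleton, isClosed_singleton⟩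
        (Set.singleton_subset_iff.mpr h)
      simp at this
    obtain ⟨b, hb, hg⟩ := h0
    rwa [Finset.card_eq_zero.mp (Nat.le_zero.mp hb)] at hg
  | succ c ih =>
    let Z (s : Set A) (t : ℕ) : Set (MaximalSpectrum R) :=
      {m | ¬ GeneratesModuloWith t m.asIdeal s}
    have hanti : Antitone (Z s) := fun t t' h m hm hg ↦ hm (hg.mono subset_rfl h)
    obtain ⟨F, hF⟩ := exists_finite_height_add_le (Z s)
      (fun t ↦ isClosed_not_generatesModuloWith t s) hanti r
      (Set.eq_empty_of_forall_notMem fun m hm ↦ hm (hr m)) c (by exact_mod_cast hdim)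
    have hy (m : MaximalSpectrum R) : ∃ y : A, ∀ x : A, x - y ∈ m.asIdeal • (⊤ : Submodule R A) →
        ∀ t, m ∈ Z s t → m ∉ Z s (t + 1) → GeneratesModuloWith t m.asIdeal (insert x s) := by
      by_cases h : ∃ t, m ∈ Z s t ∧ m ∉ Z s (t + 1)
      · obtain ⟨t, ht, ht'⟩ := h
        obtain ⟨y, hy⟩ := (not_not.mp ht').exists_insert ht
        refine ⟨y, fun x hx t₁ ht₁ ht₁' ↦ ?_⟩
        have h1 : t₁ ≤ t := not_lt.mp fun hlt ↦ ht' (hanti hlt ht₁)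
        have h2 : t ≤ t₁ := not_lt.mp fun hlt ↦ ht₁' (hanti hlt ht)
        rw [le_antisymm h1 h2]
        exact hy x hx
      · exact ⟨0, fun x _ t ht ht' ↦ (h ⟨t, ht, ht'⟩).elim⟩
    choose y hy using hy
    obtain ⟨x, hx⟩ := exists_forall_sub_mem_maximalIdeal_smul_top F y
    obtain ⟨b, hb, hg⟩ := ih (insert x s)
      (fun m ↦ (hr m).mono (Set.subset_insert x s) le_rfl)
      (hF (Z (insert x s)) (fun t m hm hg ↦ hm (hg.mono (Set.subset_insert x s) le_rfl))
        (fun t ↦ isClosed_not_generatesModuloWith t _)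
        fun m hm t ht ht' h ↦ h (hy m x (hx m hm) t ht ht'))
    refine ⟨insert x b, (Finset.card_insert_le _ _).trans (by lia), fun m ↦ ?_⟩
    rw [Finset.coe_insert, Set.union_insert, ← Set.insert_union]
    exact hg m

/-- Forster's theorem for algebras: if `dim Max R = d` and `A / mA` is generated by `r` elements for
every maximal ideal `m`, then `A` is generated by `d + r` elements. -/
theorem exists_adjoin_eq_top_of_generatesModulo [IsNoetherianRing R] (d r : ℕ)
    (hd : topologicalKrullDim (MaximalSpectrum R) = d)
    (h : ∀ m : MaximalSpectrum R, ∃ b : Finset A, b.card ≤ r ∧ GeneratesModulo m.asIdeal (b : Set A)) :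
    ∃ b : Finset A, b.card ≤ d + r ∧ NonUnitalAlgebra.adjoin R (b : Set A) = ⊤ := by
  have hr (m : MaximalSpectrum R) : GeneratesModuloWith r m.asIdeal (∅ : Set A) := by
    simpa [GeneratesModuloWith] using h m
  obtain ⟨b, hb, hg⟩ := exists_generatesModulo_of_height_add_le r (d + r) (∅ : Set A) hr <| by
    intro t Y hY
    have htr : t < r := by
      by_contra! hle
      obtain ⟨m, hm⟩ := Y.isIrreducible.nonempty
      exact hY hm ((hr m).mono subset_rfl hle)
    have hY' : Order.height Y ≤ d := by
      have := (Order.height_le_krullDim Y).trans_eq hd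
      exact_mod_cast this
    rw [add_assoc, Nat.cast_add]
    gcongr
    exact_mod_cast htr
  exact ⟨b, hb, adjoin_eq_top_of_generatesModulo (by simpa using hg)⟩

end Generation

section CentralSimple

theorem NonUnitalAlgebra.adjoin_image_eq_top {k B C : Type*} [CommRing k] [Ring B] [Algebra k B]
    [Ring C] [Algebra k C] {f : B →ₐ[k] C} (hf : Function.Surjective f) {s : Set B}
    (hs : adjoin k s = ⊤) : adjoin k (f '' s) = ⊤ := by
  rw [← NonUnitalAlgHom.map_adjoin k B f s, hs]
  refine SetLike.ext fun x ↦ ⟨fun _ ↦ trivial, fun _ ↦ ?_⟩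
  obtain ⟨y, rfl⟩ := hf x
  exact ⟨y, trivial, rfl⟩

theorem Matrix.single_mul_toMatrix_toPEquiv {n D : Type*} [Fintype n] [DecidableEq n] [Ring D]
    (σ : Equiv.Perm n) (i j : n) (a : D) :
    Matrix.single i j a * (σ.toPEquiv.toMatrix : Matrix n n D) = Matrix.single i (σ j) a := by
  rw [PEquiv.mul_toMatrix_toPEquiv]
  ext p q
  simp [Matrix.single_apply, Equiv.eq_symm_apply]

theorem Matrix.toMatrix_toPEquiv_mul_single {n D : Type*} [Fintype n] [DecidableEq n] [Ring D]
    (σ : Equiv.Perm n) (i j : n) (a : D) :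
    (σ.toPEquiv.toMatrix : Matrix n n D) * Matrix.single i j a = Matrix.single (σ.symm i) j a := by
  rw [PEquiv.toMatrix_toPEquiv_mul]
  ext p q
  simp [Matrix.single_apply, Equiv.symm_apply_eq]

/-- If the positive powers of `α` span `D`, then a matrix algebra over `D` is generated by a matrix
unit scaled by `α` and the cyclic permutation matrix. -/
theorem Matrix.adjoin_single_permMatrix_eq_top {k D : Type*} [CommRing k] [Ring D] [Algebra k D]
    (n : ℕ) [NeZero n] (α : D)
    (hα : Submodule.span k (Set.range fun i : ℕ ↦ α ^ (i + 1)) = ⊤) :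
    NonUnitalAlgebra.adjoin k {Matrix.single (0 : Fin n) (0 : Fin n) α,
      ((Equiv.addRight (1 : Fin n)).toPEquiv.toMatrix : Matrix (Fin n) (Fin n) D)} = ⊤ := by
  set P := ((Equiv.addRight (1 : Fin n)).toPEquiv.toMatrix : Matrix (Fin n) (Fin n) D)
  set B := NonUnitalAlgebra.adjoin k {Matrix.single (0 : Fin n) (0 : Fin n) α, P}
  have hP : P ∈ B := NonUnitalAlgebra.subset_adjoin k (by simp)
  have hα0 : Matrix.single (0 : Fin n) (0 : Fin n) α ∈ B :=
    NonUnitalAlgebra.subset_adjoin k (by simp)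
  have hpow (i : ℕ) : Matrix.single (0 : Fin n) (0 : Fin n) (α ^ (i + 1)) ∈ B := by
    induction i with
    | zero => simpa using hα0
    | succ i ih => simpa [pow_succ] using mul_mem ih hα0
  have hcorner (a : D) : Matrix.single (0 : Fin n) (0 : Fin n) a ∈ B := by
    have ha : a ∈ Submodule.span k (Set.range fun i : ℕ ↦ α ^ (i + 1)) := hα ▸ Submodule.mem_top
    induction ha using Submodule.span_induction with
    | mem x hx => obtain ⟨i, rfl⟩ := hx; exact hpow i
    | zero => simp
    | add x y _ _ hx hy => rw [Matrix.single_add]; exact add_mem hx hy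
    | smul c x _ hx => rw [← Matrix.smul_single]; exact SMulMemClass.smul_mem c hx
  have hrow (a : D) (j : ℕ) : Matrix.single (0 : Fin n) (j • 1 : Fin n) a ∈ B := by
    induction j with
    | zero => simpa using hcorner a
    | succ j ih =>
      rw [succ_nsmul]
      have := mul_mem ih hP
      rwa [Matrix.single_mul_toMatrix_toPEquiv] at this
  have hall (a : D) (i j : ℕ) : Matrix.single (-(i • 1) : Fin n) (j • 1 : Fin n) a ∈ B := by
    induction i with
    | zero => simpa using hrow a j
    | succ i ih =>
      rw [succ_nsmul, neg_add]
      have := mul_mem hP ih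
      rwa [Matrix.toMatrix_toPEquiv_mul_single] at this
  have hsmul (i : Fin n) : (i : ℕ) • (1 : Fin n) = i := by
    open Fin.CommRing in simp
  refine eq_top_iff.mpr fun M _ ↦ ?_
  rw [Matrix.matrix_eq_sum_single M]
  refine sum_mem fun i _ ↦ sum_mem fun j _ ↦ ?_
  simpa only [hsmul, neg_neg] using hall (M i j) (-i : Fin n) j

theorem exists_span_range_pow_succ_eq_top (k D : Type*) [Field k] [DivisionRing D] [Finite D]
    [Algebra k D] : ∃ α : D, Submodule.span k (Set.range fun i : ℕ ↦ α ^ (i + 1)) = ⊤ := by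
  have hcomm : ∀ x y : D, x * y = y * x := (Finite.isDomain_to_isField D).mul_comm
  let _ : Field D := { ‹DivisionRing D› with mul_comm := hcomm }
  obtain ⟨α, hα⟩ := IsCyclic.exists_generator (α := Dˣ)
  refine ⟨α, eq_top_iff.mpr fun d _ ↦ ?_⟩
  rcases eq_or_ne d 0 with rfl | hd
  · exact zero_mem _
  · obtain ⟨i, hi⟩ := mem_powers_iff_mem_zpowers.mpr (hα (Units.mk0 d hd * α⁻¹))
    refine Submodule.subset_span ⟨i, ?_⟩
    have := congrArg Units.val (eq_mul_inv_iff_mul_eq.mp hi)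
    simpa [pow_succ] using this

theorem exists_adjoin_pair_eq_top_of_finite (k B : Type*) [Field k] [Ring B] [Algebra k B]
    [Finite B] [IsSimpleRing B] : ∃ x y : B, NonUnitalAlgebra.adjoin k {x, y} = ⊤ := by
  obtain ⟨n, hn, D, _, _, ⟨e⟩⟩ := IsSimpleRing.exists_algEquiv_matrix_divisionRing k B
  have : Finite D := Finite.of_injective
    (fun a : D ↦ e.symm (Matrix.single (0 : Fin n) (0 : Fin n) a))
    (fun a a' h ↦ by
      simpa using congrFun (congrFun (e.symm.injective h) 0) 0)
  obtain ⟨α, hα⟩ := exists_span_range_pow_succ_eq_top k D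
  have := NonUnitalAlgebra.adjoin_image_eq_top (f := e.symm.toAlgHom) e.symm.surjective
    (Matrix.adjoin_single_permMatrix_eq_top (k := k) n α hα)
  rw [Set.image_pair] at this
  exact ⟨_, _, this⟩

theorem isSimpleRing_of_tensorProduct (k B K : Type*) [Field k] [Ring B] [Algebra k B]
    [Field K] [Algebra k K] [IsSimpleRing (K ⊗[k] B)] : IsSimpleRing B := by
  have : Nontrivial B := by
    by_contra h
    rw [not_nontrivial_iff_subsingleton] at h
    exact not_subsingleton (K ⊗[k] B) inferInstance
  refine ⟨⟨fun I ↦ ?_⟩⟩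
  rcases subsingleton_or_nontrivial I.ringCon.Quotient with hQ | hQ
  · right
    refine (TwoSidedIdeal.one_mem_iff I).mp ?_
    have : (I.ringCon.mk' 1) = I.ringCon.mk' 0 := Subsingleton.elim _ _
    have := (RingCon.eq _).mp this
    rwa [TwoSidedIdeal.rel_iff, sub_zero] at this
  · left
    let π : B →ₐ[k] I.ringCon.Quotient := { I.ringCon.mk' with commutes' := fun _ ↦ rfl }
    let Φ := Algebra.TensorProduct.map (AlgHom.id K K) π
    have hΦ : Function.Injective Φ := Φ.toRingHom.injective
    refine eq_bot_iff.mpr fun x hx ↦ ?_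
    have hπ : π x = 0 := (RingCon.eq _).mpr hx
    have : Algebra.TensorProduct.includeRight (R := k) (A := K) x = 0 := hΦ (by simp [Φ, hπ])
    have hinj := Algebra.TensorProduct.includeRight_injective (R := k) (A := K) (B := B)
      (algebraMap k K).injective
    exact hinj (by rw [this, map_zero])


theorem NonUnitalAlgebra.toSubmodule_adjoin_range {σ L C : Type*} [CommRing L] [Ring C]
    [Algebra L C] (z : σ → C) :
    (adjoin L (Set.range z)).toSubmodule =
      Submodule.span L (Set.range (FreeSemigroup.lift z)) := by
  rw [adjoin_eq_span]
  congr 1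
  refine le_antisymm (Subsemigroup.closure_le (S := (FreeSemigroup.lift z).srange).mpr ?_) ?_
  · rintro _ ⟨i, rfl⟩
    exact ⟨FreeSemigroup.of i, FreeSemigroup.lift_of z i⟩
  · rintro _ ⟨w, rfl⟩
    induction w using FreeSemigroup.recOnMul with
    | ih1 i => exact Subsemigroup.subset_closure ⟨i, rfl⟩
    | ih2 i w hi hw => rw [map_mul]; exact mul_mem hi hw

theorem FreeSemigroup.map_lift {σ M N F : Type*} [Semigroup M] [Semigroup N] [FunLike F M N]
    [MulHomClass F M N] (f : F) (z : σ → M) (w : FreeSemigroup σ) :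
    f (lift z w) = lift (f ∘ z) w := by
  induction w using FreeSemigroup.recOnMul with
  | ih1 i => rfl
  | ih2 i w hi hw => rw [map_mul, map_mul, map_mul, hi, hw]

theorem map_det_basis_tensorProduct {σ k B P L ι : Type*} [CommRing k] [Ring B] [Algebra k B]
    [CommRing P] [Algebra k P] [CommRing L] [Algebra k L] [Fintype ι] [DecidableEq ι]
    (b : Module.Basis ι k B) (φ : P →ₐ[k] L) (X : σ → P ⊗[k] B) (w : ι → FreeSemigroup σ) :
    φ ((Algebra.TensorProduct.basis P b).det fun j ↦ FreeSemigroup.lift X (w j)) =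
      (Algebra.TensorProduct.basis L b).det fun j ↦
        FreeSemigroup.lift (Algebra.TensorProduct.map φ (AlgHom.id k B) ∘ X) (w j) := by
  have hrepr (z : P ⊗[k] B) (i : ι) : φ ((Algebra.TensorProduct.basis P b).repr z i) =
      (Algebra.TensorProduct.basis L b).repr
        (Algebra.TensorProduct.map φ (AlgHom.id k B) z) i := by
    induction z with
    | zero => simp
    | tmul p a => simp
    | add z z' hz hz' => simp [hz, hz']
  rw [Module.Basis.det_apply, Module.Basis.det_apply, AlgHom.map_det]
  congr 1
  ext i j
  simp [Module.Basis.toMatrix_apply, hrepr, FreeSemigroup.map_lift]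

/-- Over an infinite field, the number of generators of a finite-dimensional algebra does not
drop under base field extension. -/
theorem exists_adjoin_range_eq_top_of_tensorProduct {σ k B K : Type*} [Field k] [Infinite k]
    [Ring B] [Algebra k B] [Module.Finite k B] [Field K] [Algebra k K] (x : σ → K ⊗[k] B)
    (hx : NonUnitalAlgebra.adjoin K (Set.range x) = ⊤) :
    ∃ y : σ → B, NonUnitalAlgebra.adjoin k (Set.range y) = ⊤ := by
  classical
  let b := Module.finBasis k B
  let P := MvPolynomial (σ × Fin (Module.finrank k B)) k
  let X : σ → P ⊗[k] B := fun s ↦ ∑ i, (MvPolynomial.X (s, i) : P) ⊗ₜ[k] b i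
  have hx' := (NonUnitalAlgebra.toSubmodule_adjoin_range (L := K) x).symm
  rw [hx, NonUnitalAlgebra.top_toSubmodule] at hx'
  obtain ⟨κ, a, -, hspan, hli⟩ := exists_linearIndependent' K (FreeSemigroup.lift x)
  let v := Module.Basis.mk hli (hspan.trans hx').ge
  let e := (Algebra.TensorProduct.basis K b).indexEquiv v
  let w : Fin (Module.finrank k B) → FreeSemigroup σ := a ∘ e
  let Δ : P := (Algebra.TensorProduct.basis P b).det fun j ↦ FreeSemigroup.lift X (w j)
  let φ : P →ₐ[k] K :=
    MvPolynomial.aeval fun p ↦ (Algebra.TensorProduct.basis K b).repr (x p.1) p.2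
  have hφ : Algebra.TensorProduct.map φ (AlgHom.id k B) ∘ X = x := by
    funext s
    conv_rhs => rw [← (Algebra.TensorProduct.basis K b).sum_repr (x s)]
    simp only [X, Function.comp_apply, map_sum, Algebra.TensorProduct.map_tmul, AlgHom.id_apply,
      Algebra.TensorProduct.basis_apply, TensorProduct.smul_tmul', smul_eq_mul, mul_one]
    exact Finset.sum_congr rfl fun i _ ↦ by rw [MvPolynomial.aeval_X]
  have hΔ0 : Δ ≠ 0 := by
    intro h
    have hdet := map_det_basis_tensorProduct b φ X w
    rw [hφ, show (Algebra.TensorProduct.basis P b).det _ = 0 from h, map_zero] at hdet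
    have hv : (fun j ↦ FreeSemigroup.lift x (w j)) = v.reindex e.symm := by
      funext j
      simp [v, w]
    rw [hv] at hdet
    exact ((Algebra.TensorProduct.basis K b).isUnit_det (v.reindex e.symm)).ne_zero hdet.symm
  obtain ⟨p, hp⟩ : ∃ p, MvPolynomial.eval p Δ ≠ 0 := by
    by_contra! h
    exact hΔ0 (MvPolynomial.funext fun p ↦ by simpa using h p)
  let ψ : P →ₐ[k] k := MvPolynomial.aeval p
  let y : σ → k ⊗[k] B := Algebra.TensorProduct.map ψ (AlgHom.id k B) ∘ X
  have hunit : IsUnit ((Algebra.TensorProduct.basis k b).det fun j ↦ FreeSemigroup.lift y (w j)) := by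
    rw [← map_det_basis_tensorProduct b ψ X w]
    exact isUnit_iff_ne_zero.mpr (by rwa [← MvPolynomial.coe_aeval_eq_eval] at hp)
  have hy : NonUnitalAlgebra.adjoin k (Set.range y) = ⊤ := by
    rw [← NonUnitalAlgebra.toSubmodule_eq_top, NonUnitalAlgebra.toSubmodule_adjoin_range]
    refine top_unique <| (Module.Basis.is_basis_iff_det _).mpr hunit |>.2.ge.trans (Submodule.span_mono ?_)
    rintro _ ⟨j, rfl⟩
    exact ⟨w j, rfl⟩
  have := NonUnitalAlgebra.adjoin_image_eq_top
    (f := (Algebra.TensorProduct.lid k B).toAlgHom) (Algebra.TensorProduct.lid k B).surjective hy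
  rw [← Set.range_comp] at this
  exact ⟨_, this⟩

theorem exists_adjoin_pair_eq_top_of_tensorProduct_equiv_matrix {k B K : Type*} [Field k] [Ring B]
    [Algebra k B] [Module.Finite k B] [Field K] [Algebra k K] {n : ℕ}
    (e : K ⊗[k] B ≃ₐ[K] Matrix (Fin n) (Fin n) K) :
    ∃ x y : B, NonUnitalAlgebra.adjoin k {x, y} = ⊤ := by
  rcases Nat.eq_zero_or_pos n with rfl | hn
  · have : Subsingleton (K ⊗[k] B) := e.toEquiv.subsingleton
    have : Subsingleton B := (Algebra.TensorProduct.includeRight_injective (R := k) (A := K) (B := B)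
      (algebraMap k K).injective).subsingleton
    refine ⟨0, 0, SetLike.ext fun x ↦ ⟨fun _ ↦ trivial, fun _ ↦ ?_⟩⟩
    rw [Subsingleton.elim x 0]
    exact zero_mem _
  have : NeZero n := ⟨hn.ne'⟩
  rcases finite_or_infinite k with hk | hk
  · have : Finite B := Module.finite_of_finite k
    have : IsSimpleRing (K ⊗[k] B) := IsSimpleRing.of_ringEquiv e.symm.toRingEquiv inferInstance
    have : IsSimpleRing B := isSimpleRing_of_tensorProduct k B K
    exact exists_adjoin_pair_eq_top_of_finite k B
  · have h := NonUnitalAlgebra.adjoin_image_eq_top (f := e.symm.toAlgHom) e.symm.surjective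
      (Matrix.adjoin_single_permMatrix_eq_top (k := K) (D := K) n 1
        (by simp))
    rw [Set.image_pair, ← Matrix.range_cons_cons_empty _ _ ![]] at h
    obtain ⟨y, hy⟩ := exists_adjoin_range_eq_top_of_tensorProduct _ h
    refine ⟨y 0, y 1, ?_⟩
    have : Set.range y = {y 0, y 1} := by
      ext z
      simp [Fin.exists_fin_two, eq_comm]
    rwa [this] at hy

end CentralSimple

theorem generatesModulo_of_adjoin_eq_top {R A : Type*} [CommRing R] [Ring A] [Algebra R A]
    {I : Ideal R} {s : Set A}
    (h : NonUnitalAlgebra.adjoin (R ⧸ I)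
      ((Algebra.TensorProduct.includeRight : A →ₐ[R] (R ⧸ I) ⊗[R] A) '' s) = ⊤) :
    GeneratesModulo I s := by
  let f : A →ₐ[R] (R ⧸ I) ⊗[R] A := Algebra.TensorProduct.includeRight
  let N : NonUnitalSubalgebra (R ⧸ I) ((R ⧸ I) ⊗[R] A) :=
    { NonUnitalSubalgebra.map f (NonUnitalAlgebra.adjoin R s) with
      smul_mem' := by
        rintro c _ ⟨a, ha, rfl⟩
        obtain ⟨r, rfl⟩ := Ideal.Quotient.mk_surjective c
        exact ⟨r • a, (NonUnitalAlgebra.adjoin R s).smul_mem' r ha, map_smul f r a⟩ }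
  have hN : N = ⊤ := by
    refine top_unique (h.ge.trans (NonUnitalAlgebra.adjoin_le ?_))
    rintro _ ⟨a, ha, rfl⟩
    exact ⟨a, NonUnitalAlgebra.subset_adjoin R ha, rfl⟩
  refine Submodule.eq_top_iff'.mpr fun x ↦ ?_
  obtain ⟨y, hy, hyx⟩ : f x ∈ N := hN ▸ trivial
  have hxy : x - y ∈ I • (⊤ : Submodule R A) := by
    have h0 : (1 : R ⧸ I) ⊗ₜ[R] (x - y) = 0 := by
      rw [TensorProduct.tmul_sub, sub_eq_zero]
      exact hyx.symm
    have := congrArg (TensorProduct.quotTensorEquivQuotSMul A I) h0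
    rw [map_zero, ← map_one (Ideal.Quotient.mk I),
      TensorProduct.quotTensorEquivQuotSMul_mk_tmul, one_smul] at this
    exact (Submodule.Quotient.mk_eq_zero _).mp this
  rw [← add_sub_cancel y x]
  exact add_mem (Submodule.mem_sup_left hy) (Submodule.mem_sup_right hxy)

/-- Successive base changes of a not necessarily commutative algebra compose. -/
noncomputable def cancelBaseChangeAlgEquiv (R S T A : Type*) [CommRing R] [CommRing S] [CommRing T]
    [Ring A] [Algebra R S] [Algebra R T] [Algebra S T] [IsScalarTower R S T] [Algebra R A] :
    T ⊗[S] (S ⊗[R] A) ≃ₐ[T] T ⊗[R] A :=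
  (Algebra.TensorProduct.algEquivOfLinearEquivTensorProduct
    (TensorProduct.AlgebraTensorModule.cancelBaseChange R S T T A).symm
    (by simp) (by simp [Algebra.TensorProduct.one_def])).symm

/-- A form of `Matₙ(R)` becomes a form of a matrix algebra over a field at every residue field. -/
theorem exists_tensorProduct_residue_equiv_matrix {R A S : Type*} [CommRing R] [Ring A]
    [Algebra R A] [CommRing S] [Algebra R S] [Module.FaithfullyFlat R S] {n : ℕ}
    (e : S ⊗[R] A ≃ₐ[S] Matrix (Fin n) (Fin n) S) (m : Ideal R) [hm : m.IsMaximal] :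
    ∃ (M : Ideal S) (_ : M.IsMaximal) (_ : M.LiesOver m),
      Nonempty ((S ⧸ M) ⊗[R ⧸ m] ((R ⧸ m) ⊗[R] A) ≃ₐ[S ⧸ M] Matrix (Fin n) (Fin n) (S ⧸ M)) := by
  have hne : m.map (algebraMap R S) ≠ ⊤ := by
    intro h
    refine Module.FaithfullyFlat.submodule_ne_top (M := S) hm ?_
    rw [Ideal.smul_top_eq_map, h]
    rfl
  obtain ⟨M, hM, hle⟩ := Ideal.exists_le_maximal _ hne
  have hlies : M.LiesOver m :=
    ⟨hm.eq_of_le (Ideal.comap_ne_top _ hM.ne_top) (Ideal.map_le_iff_le_comap.mp hle)⟩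
  let e₁ : (S ⧸ M) ⊗[R ⧸ m] ((R ⧸ m) ⊗[R] A) ≃ₐ[S ⧸ M] (S ⧸ M) ⊗[R] A :=
    cancelBaseChangeAlgEquiv R (R ⧸ m) (S ⧸ M) A
  let e₂ : (S ⧸ M) ⊗[S] (S ⊗[R] A) ≃ₐ[S ⧸ M] (S ⧸ M) ⊗[R] A :=
    cancelBaseChangeAlgEquiv R S (S ⧸ M) A
  let e₃ : (S ⧸ M) ⊗[S] (S ⊗[R] A) ≃ₐ[S ⧸ M] (S ⧸ M) ⊗[S] Matrix (Fin n) (Fin n) S :=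
    Algebra.TensorProduct.congr AlgEquiv.refl e
  let e₄ : (S ⧸ M) ⊗[S] Matrix (Fin n) (Fin n) S ≃ₐ[S ⧸ M] Matrix (Fin n) (Fin n) (S ⧸ M) :=
    AlgEquiv.ofRingEquiv (f := (matrixEquivTensor (Fin n) S (S ⧸ M)).symm.toRingEquiv) fun c ↦ by
      refine (matrixEquivTensor_apply_symm (Fin n) S (S ⧸ M) c 1).trans ?_
      simp [Algebra.algebraMap_eq_smul_one]
  exact ⟨M, hM, hlies, ⟨e₁.trans (e₂.symm.trans (e₃.trans e₄))⟩⟩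

/-- Corollary (a): if dim Max R = d, every Azumaya R-algebra (a form of Matₙ(R) under a
faithfully flat base change) is generated by d + 2 elements as a non-unital R-algebra. -/
theorem azumaya_generators (R : Type) [CommRing R] [IsNoetherianRing R] (d n : ℕ)
    (hd : topologicalKrullDim (MaximalSpectrum R) = d)
    (A : Type) [Ring A] [Algebra R A] [Module.Finite R A]
    (S : Type) [CommRing S] [Algebra R S] (hS : Module.FaithfullyFlat R S)
    (hform : Nonempty ((S ⊗[R] A) ≃ₐ[S] Matrix (Fin n) (Fin n) S)) :
    ∃ s : Finset A, s.card ≤ d + 2 ∧ GeneratesAsNonUnitalAlgebra R (s : Set A) := by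
  classical
  obtain ⟨e⟩ := hform
  obtain ⟨s, hs, hgen⟩ := exists_adjoin_eq_top_of_generatesModulo (A := A) d 2 hd fun m ↦ by
    have hm := m.isMaximal
    let _ : Field (R ⧸ m.asIdeal) := Ideal.Quotient.field m.asIdeal
    obtain ⟨M, hM, hlies, ⟨e'⟩⟩ := exists_tensorProduct_residue_equiv_matrix e m.asIdeal
    let _ : Field (S ⧸ M) := Ideal.Quotient.field M
    obtain ⟨x, y, hxy⟩ := exists_adjoin_pair_eq_top_of_tensorProduct_equiv_matrix e'
    have hsurj := Algebra.TensorProduct.includeRight_surjective (R := R) A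
      (S := R ⧸ m.asIdeal) Ideal.Quotient.mk_surjective
    obtain ⟨x, rfl⟩ := hsurj x
    obtain ⟨y, rfl⟩ := hsurj y
    refine ⟨{x, y}, Finset.card_le_two, generatesModulo_of_adjoin_eq_top ?_⟩
    rwa [Finset.coe_pair, Set.image_pair]
  refine ⟨s, hs, fun B hsB hmul ↦ ?_⟩
  have hle : NonUnitalAlgebra.adjoin R (s : Set A) ≤
      ({ B with mul_mem' := fun hx hy ↦ hmul _ hx _ hy } : NonUnitalSubalgebra R A) :=
    NonUnitalAlgebra.adjoin_le hsB
  exact Submodule.eq_top_iff'.mpr fun x ↦ hle (hgen ▸ trivial : x ∈ NonUnitalAlgebra.adjoin R _)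
end

section
/- Every central simple algebra A over a field F can be generated by two elements as a non-unital F-algebra. -/
open TensorProduct

theorem generatesAsNonUnitalAlgebra_of_adjoin_eq_top {F A : Type*} [Field F] [Ring A] [Algebra F A]
    [IsSimpleRing A] {s : Set A} (hs : Algebra.adjoin F s = ⊤) {a : A} (ha : a ∈ s) (ha0 : a ≠ 0) :
    GeneratesAsNonUnitalAlgebra F s := by
  intro B hsB hmul
  have hB : ∀ x : A, ∀ y ∈ B, x * y ∈ B ∧ y * x ∈ B := by
    intro x
    have hx : x ∈ Algebra.adjoin F s := hs ▸ Algebra.mem_top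
    induction hx using Algebra.adjoin_induction with
    | mem x hx => exact fun y hy ↦ ⟨hmul x (hsB hx) y hy, hmul y hy x (hsB hx)⟩
    | algebraMap r =>
      intro y hy
      rw [← Algebra.commutes, ← Algebra.smul_def]
      exact ⟨B.smul_mem r hy, B.smul_mem r hy⟩
    | add x z _ _ hx hz =>
      intro y hy
      rw [add_mul, mul_add]
      exact ⟨B.add_mem (hx y hy).1 (hz y hy).1, B.add_mem (hx y hy).2 (hz y hy).2⟩
    | mul x z _ _ hx hz =>
      intro y hy
      rw [mul_assoc, ← mul_assoc y]
      exact ⟨(hx _ (hz y hy).1).1, (hz _ (hx y hy).2).2⟩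
  let I : TwoSidedIdeal A := .mk' B B.zero_mem B.add_mem B.neg_mem
    (fun {x y} hy ↦ (hB x y hy).1) (fun {x y} hx ↦ (hB y x hx).2)
  have mem_I {x : A} : x ∈ I ↔ x ∈ B := TwoSidedIdeal.mem_mk' _ _ _ _ _ _ _
  have h1 : (1 : A) ∈ B := mem_I.1 (IsSimpleRing.one_mem_of_ne_zero_mem I ha0 (mem_I.2 (hsB ha)))
  exact eq_top_iff.2 fun x _ ↦ by simpa using (hB x 1 h1).1

theorem AlgHom.mulLeftRight_surjective (F A : Type*) [Field F] [Ring A] [Algebra F A]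
    [FiniteDimensional F A] [Algebra.IsCentral F A] [IsSimpleRing A] :
    Function.Surjective (AlgHom.mulLeftRight F A) := by
  intro g
  let _ : Module (A ⊗[F] Aᵐᵒᵖ) A := TensorProduct.Algebra.module
  have smul_eq (x : A) (y : Aᵐᵒᵖ) (z : A) : (x ⊗ₜ[F] y) • z = x * z * y.unop :=
    AlgHom.mulLeftRight_apply F A x y z
  have : IsSimpleModule (A ⊗[F] Aᵐᵒᵖ) A := by
    refine { eq_bot_or_eq_top := fun N ↦ ?_ }
    let I : TwoSidedIdeal A := .mk' N N.zero_mem N.add_mem N.neg_mem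
      (fun {x y} hy ↦ by simpa [smul_eq] using N.smul_mem (x ⊗ₜ[F] 1) hy)
      (fun {x y} hx ↦ by simpa [smul_eq] using N.smul_mem (1 ⊗ₜ[F] MulOpposite.op y) hx)
    have mem_I {x : A} : x ∈ I ↔ x ∈ N := TwoSidedIdeal.mem_mk' _ _ _ _ _ _ _
    refine (eq_bot_or_eq_top I).imp (fun h ↦ ?_) (fun h ↦ ?_)
    · ext x; rw [← mem_I, h]; simp
    · ext x; rw [← mem_I, h]; simp
  have smul_end (φ : Module.End (A ⊗[F] Aᵐᵒᵖ) A) : ∃ c : F, ∀ x, φ x = c • x := by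
    have left (x : A) : φ x = x * φ 1 := by
      have h := φ.map_smul (x ⊗ₜ[F] 1) 1
      rw [smul_eq, smul_eq] at h
      simpa using h
    have right (x : A) : φ x = φ 1 * x := by
      have h := φ.map_smul (1 ⊗ₜ[F] MulOpposite.op x) 1
      rw [smul_eq, smul_eq] at h
      simpa using h
    obtain ⟨c, hc⟩ := (Algebra.IsCentral.mem_center_iff F).1
      (Subalgebra.mem_center_iff.2 fun x ↦ (left x).symm.trans (right x) : φ 1 ∈ _)
    exact ⟨c, fun x ↦ by rw [right, hc, Algebra.smul_def]⟩
  let f : Module.End (Module.End (A ⊗[F] Aᵐᵒᵖ) A) A :=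
    { toFun := g
      map_add' := g.map_add
      map_smul' := fun φ x ↦ by
        obtain ⟨c, hc⟩ := smul_end φ
        simp [hc] }
  let b := Module.finBasis F A
  obtain ⟨t, ht⟩ := jacobson_density f (Finset.univ.map ⟨b, b.injective⟩)
  exact ⟨t, b.ext fun i ↦ (ht (b i) (by simp)).symm⟩

theorem IsSimpleRing.tensorProduct (F K A : Type*) [Field F] [Field K] [Algebra F K] [Ring A]
    [Algebra F A] [FiniteDimensional F A] [Algebra.IsCentral F A] [IsSimpleRing A] :
    IsSimpleRing (K ⊗[F] A) := by
  refine isSimpleRing_iff_isTwoSided_imp.2 ⟨inferInstance, fun I hI ↦ or_iff_not_imp_left.2 ?_⟩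
  intro hI0
  obtain ⟨x, hxI, hx0⟩ := Submodule.exists_mem_ne_zero_of_ne_bot hI0
  let b := Module.finBasis F A
  let bK := Algebra.TensorProduct.basis K b
  obtain ⟨i, hi⟩ : ∃ i, bK.repr x i ≠ 0 := by
    by_contra! h
    exact hx0 (bK.repr.map_eq_zero_iff.1 (Finsupp.ext h))
  have stable (t : A ⊗[F] Aᵐᵒᵖ) : (AlgHom.mulLeftRight F A t).lTensor K x ∈ I := by
    induction t with
    | zero => simp
    | add t u ht hu => simpa [LinearMap.lTensor_add] using I.add_mem ht hu
    | tmul c d =>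
      have : (AlgHom.mulLeftRight F A (c ⊗ₜ d)).lTensor K x =
          (1 ⊗ₜ[F] c) * x * (1 ⊗ₜ[F] d.unop) := by
        clear hi hx0 hxI
        induction x with
        | zero => simp
        | add y z hy hz => simp only [map_add, mul_add, add_mul, *]
        | tmul k a => simp
      rw [this]
      exact I.mul_mem_right _ (I.mul_mem_left _ hxI)
  have coord : ((b.coord i).smulRight (1 : A)).lTensor K x = bK.repr x i ⊗ₜ[F] 1 := by
    clear hi hx0 hxI stable
    induction x with
    | zero => simp
    | add y z hy hz => simp only [map_add, hy, hz, Finsupp.add_apply, TensorProduct.add_tmul]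
    | tmul k a =>
      rw [LinearMap.lTensor_tmul, LinearMap.smulRight_apply, ← TensorProduct.smul_tmul]
      simp [bK, Algebra.TensorProduct.basis_repr_tmul, Algebra.smul_def, mul_comm]
  obtain ⟨t, ht⟩ := AlgHom.mulLeftRight_surjective F A ((b.coord i).smulRight (1 : A))
  have hmem : bK.repr x i ⊗ₜ[F] (1 : A) ∈ I := coord ▸ ht ▸ stable t
  rw [Ideal.eq_top_iff_one, Algebra.TensorProduct.one_def, ← inv_mul_cancel₀ hi]
  simpa using I.mul_mem_left ((bK.repr x i)⁻¹ ⊗ₜ[F] (1 : A)) hmem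

open scoped Fin.NatCast Fin.CommRing in
theorem Matrix.exists_adjoin_range_eq_top (R : Type*) [CommRing R] (n : ℕ) [NeZero n] :
    ∃ f : Fin 2 → Matrix (Fin n) (Fin n) R, Algebra.adjoin R (Set.range f) = ⊤ := by
  let P : Matrix (Fin n) (Fin n) R := Matrix.of fun i j ↦ if i = j + 1 then 1 else 0
  refine ⟨![Matrix.single 0 0 1, P], ?_⟩
  set S := Algebra.adjoin R (Set.range ![Matrix.single 0 0 1, P])
  have hE : Matrix.single 0 0 1 ∈ S := Algebra.subset_adjoin ⟨0, rfl⟩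
  have hP : P ∈ S := Algebra.subset_adjoin ⟨1, rfl⟩
  have mul_P (i j : Fin n) : Matrix.single i j 1 * P = Matrix.single i (j - 1) 1 := by
    ext k l
    by_cases hk : i = k
    · subst hk
      simp [P, Matrix.single_apply, sub_eq_iff_eq_add]
    · simp [hk, Ne.symm hk]
  have P_mul (i j : Fin n) : P * Matrix.single i j 1 = Matrix.single (i + 1) j 1 := by
    ext k l
    by_cases hl : j = l
    · subst hl
      simp [P, Matrix.single_apply, eq_comm]
    · simp [hl, Ne.symm hl]
  have col (k : ℕ) : Matrix.single (k : Fin n) 0 1 ∈ S := by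
    induction k with
    | zero => simpa using hE
    | succ k ih => simpa [P_mul] using S.mul_mem hP ih
  have all (k l : ℕ) : Matrix.single (k : Fin n) (-l : Fin n) 1 ∈ S := by
    induction l with
    | zero => simpa using col k
    | succ l ih => simpa [mul_P, sub_eq_add_neg, add_comm] using S.mul_mem ih hP
  refine eq_top_iff.2 fun M _ ↦ ?_
  rw [M.matrix_eq_sum_single]
  refine S.sum_mem fun i _ ↦ S.sum_mem fun j _ ↦ ?_
  simpa [Matrix.smul_single] using S.smul_mem (all i (-j : Fin n)) (M i j)

theorem AlgEquiv.exists_adjoin_range_eq_top {R A B X : Type*} [CommSemiring R] [Semiring A]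
    [Semiring B] [Algebra R A] [Algebra R B] (e : A ≃ₐ[R] B)
    (h : ∃ f : X → A, Algebra.adjoin R (Set.range f) = ⊤) :
    ∃ f : X → B, Algebra.adjoin R (Set.range f) = ⊤ := by
  obtain ⟨f, hf⟩ := h
  refine ⟨e ∘ f, ?_⟩
  have := (e : A →ₐ[R] B).map_adjoin (Set.range f)
  rw [hf, Algebra.map_top, (AlgHom.range_eq_top _).2 e.surjective, ← Set.range_comp] at this
  exact this.symm

theorem Algebra.adjoin_range_eq_top_iff_span_lift {R A X : Type*} [CommSemiring R] [Semiring A]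
    [Algebra R A] (f : X → A) : Algebra.adjoin R (Set.range f) = ⊤ ↔
      Submodule.span R (Set.range (FreeMonoid.lift f)) = ⊤ := by
  rw [← MonoidHom.coe_mrange, FreeMonoid.mrange_lift, ← Algebra.adjoin_eq_span,
    Algebra.toSubmodule_eq_top]

theorem Algebra.TensorProduct.basis_repr_map {F A R S ι : Type*} [CommRing F] [Ring A] [Algebra F A]
    [CommRing R] [Algebra F R] [CommRing S] [Algebra F S] (b : Module.Basis ι F A)
    (φ : R →ₐ[F] S) (x : R ⊗[F] A) (i : ι) :
    (Algebra.TensorProduct.basis S b).repr (Algebra.TensorProduct.map φ (AlgHom.id F A) x) i =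
      φ ((Algebra.TensorProduct.basis R b).repr x i) := by
  induction x with
  | zero => simp
  | add y z hy hz => simp [hy, hz]
  | tmul r a => simp [Algebra.TensorProduct.basis_repr_tmul]

theorem Algebra.TensorProduct.basis_det_map {F A R S ι : Type*} [CommRing F] [Ring A] [Algebra F A]
    [CommRing R] [Algebra F R] [CommRing S] [Algebra F S] [Fintype ι] [DecidableEq ι]
    (b : Module.Basis ι F A) (φ : R →ₐ[F] S) (v : ι → R ⊗[F] A) :
    (Algebra.TensorProduct.basis S b).det
        (fun i ↦ Algebra.TensorProduct.map φ (AlgHom.id F A) (v i)) =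
      φ ((Algebra.TensorProduct.basis R b).det v) := by
  rw [Module.Basis.det_apply, Module.Basis.det_apply, AlgHom.map_det]
  congr 1
  ext i j
  rw [AlgHom.mapMatrix_apply, Matrix.map_apply, Module.Basis.toMatrix_apply,
    Module.Basis.toMatrix_apply, Algebra.TensorProduct.basis_repr_map]

/-- The tuple of generic elements of `A` with respect to the basis `b`, indexed by `X`. -/
noncomputable def Module.Basis.genericElement {F A ι : Type*} [CommRing F] [Ring A] [Algebra F A]
    [Fintype ι] (b : Module.Basis ι F A) {X : Type*} (x : X) : MvPolynomial (X × ι) F ⊗[F] A :=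
  ∑ i, MvPolynomial.X (x, i) ⊗ₜ[F] b i

theorem Module.Basis.map_aeval_genericElement {F A S ι X : Type*} [CommRing F] [Ring A]
    [Algebra F A] [CommRing S] [Algebra F S] [Fintype ι] (b : Module.Basis ι F A)
    (c : X → S ⊗[F] A) :
    Algebra.TensorProduct.map (MvPolynomial.aeval fun y : X × ι ↦
      (Algebra.TensorProduct.basis S b).repr (c y.1) y.2) (AlgHom.id F A) ∘ b.genericElement =
      c := by
  ext x
  rw [Function.comp_apply, genericElement, map_sum]
  conv_rhs => rw [← (Algebra.TensorProduct.basis S b).sum_repr (c x)]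
  simp [TensorProduct.smul_tmul']

theorem Module.Basis.aeval_det_lift_genericElement {F A S ι X : Type*} [CommRing F] [Ring A]
    [Algebra F A] [CommRing S] [Algebra F S] [Fintype ι] [DecidableEq ι] (b : Module.Basis ι F A)
    (w : ι → FreeMonoid X) (c : X → S ⊗[F] A) :
    MvPolynomial.aeval (fun y : X × ι ↦ (Algebra.TensorProduct.basis S b).repr (c y.1) y.2)
        ((Algebra.TensorProduct.basis (MvPolynomial (X × ι) F) b).det
          fun i ↦ FreeMonoid.lift b.genericElement (w i)) =
      (Algebra.TensorProduct.basis S b).det fun i ↦ FreeMonoid.lift c (w i) := by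
  rw [← Algebra.TensorProduct.basis_det_map]
  congr 1
  ext i
  conv_rhs => rw [← b.map_aeval_genericElement c]
  exact FreeMonoid.hom_map_lift (Algebra.TensorProduct.map _ _ : _ →ₐ[F] _).toMonoidHom _ _

/-- Over an infinite field, the number of elements needed to generate a finite-dimensional algebra
does not change under extension of the base field. -/
theorem Algebra.exists_adjoin_range_eq_top_of_baseChange {F K A X : Type*} [Field F] [Infinite F]
    [Field K] [Algebra F K] [Ring A] [Algebra F A] [FiniteDimensional F A]
    (h : ∃ f : X → K ⊗[F] A, Algebra.adjoin K (Set.range f) = ⊤) :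
    ∃ f : X → A, Algebra.adjoin F (Set.range f) = ⊤ := by
  obtain ⟨f, hf⟩ := h
  rw [Algebra.adjoin_range_eq_top_iff_span_lift] at hf
  let b := Module.finBasis F A
  let bK := Algebra.TensorProduct.basis K b
  let bF := Algebra.TensorProduct.basis F b
  obtain ⟨κ, w, -, hspan, hli⟩ := exists_linearIndependent' K (FreeMonoid.lift f)
  let v : Module.Basis κ K (K ⊗[F] A) := .mk hli (hspan.trans hf).ge
  let σ := bK.indexEquiv v
  let D := (Algebra.TensorProduct.basis (MvPolynomial (X × _) F) b).det
    fun i ↦ FreeMonoid.lift b.genericElement (w (σ i))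
  have hD : D ≠ 0 := by
    intro hD
    have hdet := b.aeval_det_lift_genericElement (w ∘ σ) f
    refine (bK.isUnit_det (v.reindex σ.symm)).ne_zero ?_
    have hv : ⇑(v.reindex σ.symm) = fun i ↦ FreeMonoid.lift f ((w ∘ σ) i) := by
      ext i
      simp [v]
    rw [hv, ← hdet]
    exact (congrArg _ hD).trans (map_zero _)
  obtain ⟨z, hz⟩ : ∃ z, MvPolynomial.eval z D ≠ 0 := by
    by_contra! hz
    exact hD (MvPolynomial.funext fun z ↦ by simpa using hz z)
  let g : X → F ⊗[F] A := fun x ↦ ∑ i, z (x, i) • bF i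
  have hgz : (fun y ↦ bF.repr (g y.1) y.2) = z := by
    ext y
    simp only [g]
    rw [bF.repr_sum_self]
  have hg : IsUnit (bF.det fun i ↦ FreeMonoid.lift g ((w ∘ σ) i)) := by
    rw [← b.aeval_det_lift_genericElement (w ∘ σ) g, isUnit_iff_ne_zero, hgz]
    simpa [MvPolynomial.aeval_eq_eval] using hz
  refine (Algebra.TensorProduct.lid F A).exists_adjoin_range_eq_top ⟨g, ?_⟩
  rw [Algebra.adjoin_range_eq_top_iff_span_lift]
  exact top_unique ((bF.is_basis_iff_det.2 hg).2.ge.trans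
    (Submodule.span_mono (Set.range_comp_subset_range (w ∘ σ) _)))

theorem IsSimpleRing.exists_algEquiv_matrix_of_finite (F A : Type*) [Field F] [Finite F] [Ring A]
    [Algebra F A] [FiniteDimensional F A] [Algebra.IsCentral F A] [IsSimpleRing A] :
    ∃ (n : ℕ) (_ : NeZero n), Nonempty (A ≃ₐ[F] Matrix (Fin n) (Fin n) F) := by
  have := IsArtinianRing.of_finite F A
  obtain ⟨n, hn, D, _, _, _, ⟨e⟩⟩ := exists_algEquiv_matrix_divisionRing_finite F A
  have : Finite D := Module.finite_of_finite F
  have hcomm (x y : D) : x * y = y * x := (Finite.isDomain_to_isField D).mul_comm x y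
  have : Algebra.IsCentral F (Matrix (Fin n) (Fin n) D) := .of_algEquiv F _ _ e
  refine ⟨n, hn, ⟨e.trans (.mapMatrix (.symm (.ofBijective (Algebra.ofId F D)
    ⟨FaithfulSMul.algebraMap_injective F D, fun d ↦ ?_⟩)))⟩⟩
  obtain ⟨c, hc⟩ := (Algebra.IsCentral.mem_center_iff F).1
    (Subalgebra.mem_center_iff.2 fun M ↦ (Matrix.scalar_commute d (hcomm d) M).symm.eq :
      Matrix.scalar (Fin n) d ∈ _)
  refine ⟨c, ?_⟩
  simpa [Matrix.algebraMap_matrix_apply] using congr($hc 0 0).symm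

theorem IsSimpleRing.exists_adjoin_range_eq_top (F A : Type*) [Field F] [Ring A] [Algebra F A]
    [FiniteDimensional F A] [Algebra.IsCentral F A] [IsSimpleRing A] :
    ∃ f : Fin 2 → A, Algebra.adjoin F (Set.range f) = ⊤ := by
  cases finite_or_infinite F with
  | inl _ =>
    obtain ⟨n, _, ⟨e⟩⟩ := exists_algEquiv_matrix_of_finite F A
    exact e.symm.exists_adjoin_range_eq_top (Matrix.exists_adjoin_range_eq_top F n)
  | inr _ =>
    let K := AlgebraicClosure F
    have := IsSimpleRing.tensorProduct F K A
    obtain ⟨n, _, ⟨e⟩⟩ := exists_algEquiv_matrix_of_isAlgClosed K (K ⊗[F] A)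
    exact Algebra.exists_adjoin_range_eq_top_of_baseChange
      (e.symm.exists_adjoin_range_eq_top (Matrix.exists_adjoin_range_eq_top K n))

/-- Every central simple algebra over a field F can be generated by two elements as a
non-unital F-algebra. -/
theorem central_simple_two_generators (F : Type) [Field F]
    (A : Type) [Ring A] [Algebra F A] [FiniteDimensional F A]
    [Algebra.IsCentral F A] [IsSimpleRing A] :
    ∃ a b : A, GeneratesAsNonUnitalAlgebra F ({a, b} : Set A) := by
  obtain ⟨f, hf⟩ := IsSimpleRing.exists_adjoin_range_eq_top F A
  by_cases h : ∃ i, f i ≠ 0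
  · obtain ⟨i, hi⟩ := h
    have hrange : Set.range f = {f 0, f 1} := by ext; simp [eq_comm]
    exact ⟨f 0, f 1, hrange ▸ generatesAsNonUnitalAlgebra_of_adjoin_eq_top hf ⟨i, rfl⟩ hi⟩
  · push Not at h
    refine ⟨1, 1, generatesAsNonUnitalAlgebra_of_adjoin_eq_top (eq_top_iff.2 ?_)
      (Set.mem_insert _ _) one_ne_zero⟩
    rw [← hf]
    refine Algebra.adjoin_le ?_
    rintro _ ⟨i, rfl⟩
    rw [h i]
    exact zero_mem _
end
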